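/- arXiv:1301.4603 — 3 statements merged into one kernel-verified Lean document; each statement's English description precedes it below -/
import Mathlib

section
/- Let T ∈ F^{I×I×K} be an SFS-tensor of rank R and suppose the CPD of T is unique. Then the SFS-rank of T equals r_T, and the SFS-CPD of T is also unique. -/
open scoped Matrix
open MeasureTheory

variable {F : Type*} [RCLike F]

/-- The k-rank of a matrix: the largest `k` such that every subset of `k` columns is
linearly independent. -/
noncomputable def krank {I R : ℕ} (A : Matrix (Fin I) (Fin R) F) : ℕ :=
  sSup {k | k ≤ R ∧ ∀ s : Finset (Fin R), s.card = k →
    LinearIndependent F (fun r : {x // x ∈ s} => A.transpose r.1)}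

/-- The tensor `[A,B,C]_R` with entries `t_{ijk} = ∑ r, a_r(i) b_r(j) c_r(k)`. -/
def pdTensor {I J K R : ℕ} (A : Matrix (Fin I) (Fin R) F) (B : Matrix (Fin J) (Fin R) F)
    (C : Matrix (Fin K) (Fin R) F) : Fin I → Fin J → Fin K → F :=
  fun i j k => ∑ r, A i r * B j r * C k r

/-- `T = [A,B,C]_R` is a polyadic decomposition of `T` (columns are required nonzero). -/
def IsPD {I J K R : ℕ} (T : Fin I → Fin J → Fin K → F) (A : Matrix (Fin I) (Fin R) F)
    (B : Matrix (Fin J) (Fin R) F) (C : Matrix (Fin K) (Fin R) F) : Prop :=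
  (∀ r, A.transpose r ≠ 0) ∧ (∀ r, B.transpose r ≠ 0) ∧ (∀ r, C.transpose r ≠ 0) ∧
    T = pdTensor A B C

/-- The rank of a tensor: the minimal number of rank-1 terms in a PD. -/
noncomputable def tensorRank {I J K : ℕ} (T : Fin I → Fin J → Fin K → F) : ℕ :=
  sInf {R | ∃ A : Matrix (Fin I) (Fin R) F, ∃ B : Matrix (Fin J) (Fin R) F,
    ∃ C : Matrix (Fin K) (Fin R) F, IsPD T A B C}

/-- The CPD of `T` (with `R` terms) is (essentially) unique: any two PDs with `R` terms
coincide up to permutation and scaling. -/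
def CPDUnique {I J K : ℕ} (T : Fin I → Fin J → Fin K → F) (R : ℕ) : Prop :=
  ∀ (A A' : Matrix (Fin I) (Fin R) F) (B B' : Matrix (Fin J) (Fin R) F)
    (C C' : Matrix (Fin K) (Fin R) F), IsPD T A B C → IsPD T A' B' C' →
    ∃ σ : Equiv.Perm (Fin R), ∃ la lb lc : Fin R → F,
      (∀ r, la r * lb r * lc r = 1) ∧
      (∀ i r, A' i r = A i (σ r) * la r) ∧
      (∀ j r, B' j r = B j (σ r) * lb r) ∧
      (∀ k r, C' k r = C k (σ r) * lc r)

/-- The third factor matrix of `T` (with `R` terms) is (essentially) unique. -/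
def ThirdFactorUnique {I J K : ℕ} (T : Fin I → Fin J → Fin K → F) (R : ℕ) : Prop :=
  ∀ (A A' : Matrix (Fin I) (Fin R) F) (B B' : Matrix (Fin J) (Fin R) F)
    (C C' : Matrix (Fin K) (Fin R) F), IsPD T A B C → IsPD T A' B' C' →
    ∃ σ : Equiv.Perm (Fin R), ∃ lc : Fin R → F, (∀ r, lc r ≠ 0) ∧
      (∀ k r, C' k r = C k (σ r) * lc r)

/-- The `m`-th compound matrix: the matrix of all `m × m` minors of `A`, with rows and
columns indexed by the `m`-element index subsets (taken in increasing order). -/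
noncomputable def compound {I R : ℕ} (m : ℕ) (A : Matrix (Fin I) (Fin R) F) :
    Matrix {s : Finset (Fin I) // s.card = m} {t : Finset (Fin R) // t.card = m} F :=
  fun s t => Matrix.det (Matrix.of fun i j : Fin m =>
    A (s.1.orderIsoOfFin s.2 i).1 (t.1.orderIsoOfFin t.2 j).1)

/-- Khatri–Rao (column-wise Kronecker) product. -/
def khatriRao {α β γ : Type*} (A : Matrix α γ F) (B : Matrix β γ F) : Matrix (α × β) γ F :=
  fun p c => A p.1 c * B p.2 c

/-- A matrix has full column rank iff its columns are linearly independent. -/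
def FullColRank {α γ : Type*} (M : Matrix α γ F) : Prop :=
  LinearIndependent F M.transpose

/-- The vector `d̂^(m)` of all products `d_{i₁} ⋯ d_{i_m}`, `i₁ < ⋯ < i_m`. -/
def hatVec {R : ℕ} (m : ℕ) (d : Fin R → F) : {t : Finset (Fin R) // t.card = m} → F :=
  fun t => ∏ i ∈ t.1, d i

/-- Condition (Um) for the pair `(A, B)`. -/
def CondU {I J R : ℕ} (m : ℕ) (A : Matrix (Fin I) (Fin R) F)
    (B : Matrix (Fin J) (Fin R) F) : Prop :=
  ∀ d : Fin R → F,
    (khatriRao (compound m A) (compound m B)).mulVec (hatVec m d) = 0 → hatVec m d = 0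

/-- Condition (Wm) for the triple `(A, B, C)`. -/
def CondW {I J K R : ℕ} (m : ℕ) (A : Matrix (Fin I) (Fin R) F)
    (B : Matrix (Fin J) (Fin R) F) (C : Matrix (Fin K) (Fin R) F) : Prop :=
  ∀ d : Fin R → F, (∃ x : Fin K → F, d = C.transpose.mulVec x) →
    (khatriRao (compound m A) (compound m B)).mulVec (hatVec m d) = 0 → hatVec m d = 0

/-- Condition (Hm) for the pair `(A, B)`: `H_{AB}(δ) ≥ min(δ, m)` for `δ = 1, …, R`. -/
def CondH {I J R : ℕ} (m : ℕ) (A : Matrix (Fin I) (Fin R) F)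
    (B : Matrix (Fin J) (Fin R) F) : Prop :=
  ∀ δ : ℕ, 1 ≤ δ → δ ≤ R → ∀ s : Finset (Fin R), s.card = δ →
    δ + min δ m ≤ (A.submatrix id (fun x : {y // y ∈ s} => x.1)).rank +
      (B.submatrix id (fun x : {y // y ∈ s} => x.1)).rank

/-- `T = [A,A,C]_R` is an SFS-PD of `T` (columns are required nonzero). -/
def IsSFSPD {I K R : ℕ} (T : Fin I → Fin I → Fin K → F) (A : Matrix (Fin I) (Fin R) F)
    (C : Matrix (Fin K) (Fin R) F) : Prop :=
  (∀ r, A.transpose r ≠ 0) ∧ (∀ r, C.transpose r ≠ 0) ∧ T = pdTensor A A C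

/-- The SFS-rank of a tensor: the minimal number of SFS-rank-1 terms in an SFS-PD. -/
noncomputable def sfsRank {I K : ℕ} (T : Fin I → Fin I → Fin K → F) : ℕ :=
  sInf {R | ∃ A : Matrix (Fin I) (Fin R) F, ∃ C : Matrix (Fin K) (Fin R) F, IsSFSPD T A C}

/-- The SFS-CPD of `T` (with `R` terms) is (essentially) unique. -/
def SFSCPDUnique {I K : ℕ} (T : Fin I → Fin I → Fin K → F) (R : ℕ) : Prop :=
  ∀ (A A' : Matrix (Fin I) (Fin R) F) (C C' : Matrix (Fin K) (Fin R) F),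
    IsSFSPD T A C → IsSFSPD T A' C' →
    ∃ σ : Equiv.Perm (Fin R), ∃ la lc : Fin R → F,
      (∀ r, la r * la r * lc r = 1) ∧
      (∀ i r, A' i r = A i (σ r) * la r) ∧
      (∀ k r, C' k r = C k (σ r) * lc r)

theorem IsSFSPD.isPD {I K R : ℕ} {T : Fin I → Fin I → Fin K → F}
    {A : Matrix (Fin I) (Fin R) F} {C : Matrix (Fin K) (Fin R) F} (h : IsSFSPD T A C) :
    IsPD T A A C := ⟨h.1, h.1, h.2.1, h.2.2⟩

theorem sfsUnique_of_cpdUnique {I K R : ℕ} {T : Fin I → Fin I → Fin K → F}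
    (huniq : CPDUnique T R) : SFSCPDUnique T R := by
  intro A A' C C' h h'
  obtain ⟨σ, la, lb, lc, h1, hA, hB, hC⟩ := huniq A A' A A' C C' h.isPD h'.isPD
  have hab : ∀ r, lb r = la r := by
    intro r
    obtain ⟨i, hi⟩ := Function.ne_iff.mp (h.1 (σ r))
    have := (hA i r).symm.trans (hB i r)
    exact (mul_left_cancel₀ hi this).symm
  refine ⟨σ, la, lc, fun r => ?_, hA, hC⟩
  have := h1 r
  rwa [hab r] at this

/-- If some pair of columns `a_r, b_r` is not parallel, swapping the first two modes and using
uniqueness produces a different PD, a contradiction. -/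
theorem parallel_of_unique {I K R : ℕ} {T : Fin I → Fin I → Fin K → F}
    (hsym : ∀ i j k, T i j k = T j i k) (huniq : CPDUnique T R)
    {A B : Matrix (Fin I) (Fin R) F} {C : Matrix (Fin K) (Fin R) F} (h : IsPD T A B C) :
    ∀ r, ∃ m : F, ∀ i, B i r = m * A i r := by
  classical
  intro r
  by_contra hr
  obtain ⟨hA0, hB0, hC0, hT⟩ := h
  have hswap : IsPD T B A C := by
    refine ⟨hB0, hA0, hC0, ?_⟩
    funext i j k
    rw [hsym, hT]
    simp only [pdTensor]
    exact Finset.sum_congr rfl fun p _ => by ring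
  obtain ⟨σ, la, lb, lc, h1, hA, hB, hC⟩ := huniq A B B A C C ⟨hA0, hB0, hC0, hT⟩ hswap
  obtain ⟨s, hs⟩ : ∃ s, s = σ r := ⟨_, rfl⟩
  have hsr : s ≠ r := by
    intro e
    apply hr
    refine ⟨la r, fun i => ?_⟩
    rw [hA i r, ← hs, e, mul_comm]
  have hterm : ∀ i j k, A i s * B j s * C k s = B i r * A j r * C k r := by
    intro i j k
    rw [hA i r, hB j r, hC k r, ← hs]
    linear_combination (-(A i s * B j s * C k s)) * h1 r
  have hplus : ¬ ∀ i, A i r + B i r = 0 := fun e =>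
    hr ⟨-1, fun i => by linear_combination e i⟩
  have hminus : ¬ ∀ i, A i r - B i r = 0 := fun e =>
    hr ⟨1, fun i => by linear_combination - e i⟩
  let A' : Matrix (Fin I) (Fin R) F := fun i p =>
    if p = r then A i r + B i r else if p = s then A i r - B i r else A i p
  let B' : Matrix (Fin I) (Fin R) F := fun i p =>
    if p = r then A i r + B i r else if p = s then A i r - B i r else B i p
  let C' : Matrix (Fin K) (Fin R) F := fun k p =>
    if p = r then C k r * 2⁻¹ else if p = s then - C k r * 2⁻¹ else C k p
  have hPD : IsPD T A' B' C' := by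
    refine ⟨fun p e => ?_, fun p e => ?_, fun p e => ?_, ?_⟩
    · have e' : ∀ i, A' i p = 0 := fun i => congrFun e i
      by_cases h1 : p = r
      · exact hplus fun i => by simpa [A', h1] using e' i
      by_cases h2 : p = s
      · exact hminus fun i => by simpa [A', h2, hsr] using e' i
      exact hA0 p (funext fun i => by simpa [A', h1, h2] using e' i)
    · have e' : ∀ i, B' i p = 0 := fun i => congrFun e i
      by_cases h1 : p = r
      · exact hplus fun i => by simpa [B', h1] using e' i
      by_cases h2 : p = s
      · exact hminus fun i => by simpa [B', h2, hsr] using e' i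
      exact hB0 p (funext fun i => by simpa [B', h1, h2] using e' i)
    · have e' : ∀ i, C' i p = 0 := fun i => congrFun e i
      by_cases h1 : p = r
      · exact hC0 r (funext fun i => by simpa [C', h1] using e' i)
      by_cases h2 : p = s
      · exact hC0 r (funext fun i => by simpa [C', h2, hsr] using e' i)
      exact hC0 p (funext fun i => by simpa [C', h1, h2] using e' i)
    · rw [hT]
      funext i j k
      have hmem : s ∈ Finset.univ.erase r := by simp [hsr]
      simp only [pdTensor]
      rw [← Finset.add_sum_erase _ _ (Finset.mem_univ r), ← Finset.add_sum_erase _ _ hmem,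
        ← Finset.add_sum_erase _ (fun p => A' i p * B' j p * C' k p) (Finset.mem_univ r),
        ← Finset.add_sum_erase _ (fun p => A' i p * B' j p * C' k p) hmem]
      have hrest : ∑ p ∈ (Finset.univ.erase r).erase s, A i p * B j p * C k p =
          ∑ p ∈ (Finset.univ.erase r).erase s, A' i p * B' j p * C' k p := by
        refine Finset.sum_congr rfl fun p hp => ?_
        simp only [Finset.mem_erase] at hp
        simp [A', B', C', hp.1, hp.2.1]
      rw [hrest, hterm, ← add_assoc, ← add_assoc]
      congr 1
      simp only [A', B', C', if_true, if_neg hsr]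
      field_simp
      ring
  obtain ⟨τ, ma, mb, mc, g1, gA, gB, gC⟩ :=
    huniq A A' B B' C C' ⟨hA0, hB0, hC0, hT⟩ hPD
  have hcard : (Finset.univ.filter fun p => ∃ m : F, ∀ i, B' i p = m * A' i p).card =
      (Finset.univ.filter fun p => ∃ m : F, ∀ i, B i p = m * A i p).card := by
    refine Finset.card_bij' (fun p _ => τ p) (fun p _ => τ.symm p) ?_ ?_ (by simp) (by simp)
    · intro p hp
      simp only [Finset.mem_filter, Finset.mem_univ, true_and] at hp ⊢
      obtain ⟨m, hm⟩ := hp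
      have hb : mb p ≠ 0 := fun e => by simpa [e] using g1 p
      refine ⟨m * ma p / mb p, fun i => ?_⟩
      have := hm i
      rw [gA, gB] at this
      field_simp
      linear_combination this
    · intro p hp
      simp only [Finset.mem_filter, Finset.mem_univ, true_and] at hp ⊢
      obtain ⟨m, hm⟩ := hp
      have ha : ma (τ.symm p) ≠ 0 := fun e => by simpa [e] using g1 (τ.symm p)
      refine ⟨m * mb (τ.symm p) / ma (τ.symm p), fun i => ?_⟩
      rw [gA, gB, Equiv.apply_symm_apply, hm i]
      field_simp
  refine absurd hcard (ne_of_gt (Finset.card_lt_card ?_))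
  rw [Finset.ssubset_iff_of_subset]
  · refine ⟨r, ?_, ?_⟩
    · simp only [Finset.mem_filter, Finset.mem_univ, true_and]
      exact ⟨1, fun i => by simp [A', B']⟩
    · simpa using hr
  · intro p hp
    simp only [Finset.mem_filter, Finset.mem_univ, true_and] at hp ⊢
    by_cases h1 : p = r
    · exact ⟨1, fun i => by simp [A', B', h1]⟩
    by_cases h2 : p = s
    · exact ⟨1, fun i => by simp [A', B', h2]⟩
    simpa [A', B', h1, h2] using hp

theorem exists_sfs_of_unique {I K R : ℕ} {T : Fin I → Fin I → Fin K → F}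
    (hsym : ∀ i j k, T i j k = T j i k) (huniq : CPDUnique T R)
    {A B : Matrix (Fin I) (Fin R) F} {C : Matrix (Fin K) (Fin R) F} (h : IsPD T A B C) :
    ∃ A : Matrix (Fin I) (Fin R) F, ∃ C : Matrix (Fin K) (Fin R) F, IsSFSPD T A C := by
  choose m hm using parallel_of_unique hsym huniq h
  obtain ⟨hA0, hB0, hC0, hT⟩ := h
  have hm0 : ∀ r, m r ≠ 0 := fun r e =>
    hB0 r (funext fun i => by simpa [e] using hm r i)
  refine ⟨A, fun k r => m r * C k r, hA0, fun r e => ?_, ?_⟩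
  · refine hC0 r (funext fun k => ?_)
    have : m r * C k r = 0 := congrFun e k
    simpa [hm0 r] using this
  · rw [hT]
    funext i j k
    simp only [pdTensor]
    exact Finset.sum_congr rfl fun p _ => by rw [hm p j]; ring

/-- Lemma 4.7: for an SFS-tensor with unique CPD, the SFS-rank equals the
rank and the SFS-CPD is also unique. -/
theorem stmt_14 {I K R : ℕ} (T : Fin I → Fin I → Fin K → F)
    (hsym : ∀ i j k, T i j k = T j i k)
    (hrank : tensorRank T = R) (huniq : CPDUnique T R) :
    sfsRank T = R ∧ SFSCPDUnique T R := by
  refine ⟨?_, sfsUnique_of_cpdUnique huniq⟩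
  have hsub : {R | ∃ A : Matrix (Fin I) (Fin R) F, ∃ C : Matrix (Fin K) (Fin R) F,
      IsSFSPD T A C} ⊆ {R | ∃ A : Matrix (Fin I) (Fin R) F, ∃ B : Matrix (Fin I) (Fin R) F,
      ∃ C : Matrix (Fin K) (Fin R) F, IsPD T A B C} := by
    rintro S ⟨A, C, h⟩
    exact ⟨A, A, C, h.isPD⟩
  rcases Set.eq_empty_or_nonempty {R | ∃ A : Matrix (Fin I) (Fin R) F,
      ∃ B : Matrix (Fin I) (Fin R) F, ∃ C : Matrix (Fin K) (Fin R) F, IsPD T A B C} with he | hne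
  · have he' := Set.subset_eq_empty hsub he
    rw [← hrank, sfsRank, tensorRank, he, he']
  · have hmem := Nat.sInf_mem hne
    change tensorRank T ∈ _ at hmem
    rw [hrank] at hmem
    obtain ⟨A, B, C, h⟩ := hmem
    have hS := exists_sfs_of_unique hsym huniq h
    refine le_antisymm (Nat.sInf_le hS) ?_
    rw [← hrank]
    exact Nat.sInf_le (hsub (Nat.sInf_mem ⟨R, hS⟩))
end

section
/- Let T = [A,A,C]_R with A ∈ F^{I×R}, C ∈ F^{K×R}, and set m_C := R − r_C + 2. Assume: (i) k_A + k_C ≥ R + 2; (ii) C_{m_C}(A)⊙C_{m_C}(A) has full column rank. Then the SFS-rank of T equals R and the SFS-CPD of T is unique. -/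
open scoped Matrix
open MeasureTheory

variable {F : Type*} [RCLike F]

section Helpers

open Matrix Equiv in
lemma aux_gram_det {m n : ℕ} (M N : Matrix (Fin m) (Fin n) F) (d : Fin n → F) :
    (m.factorial : F) * (M * diagonal d * Nᵀ).det =
      ∑ f : Fin m → Fin n, (∏ i, d (f i)) * ((M.submatrix id f).det * (N.submatrix id f).det) := by
  have h1 : (M * diagonal d * Nᵀ).det =
      ∑ f : Fin m → Fin n, (∏ i, M i (f i) * d (f i)) * (N.submatrix id f).det := by
    have e : (M * diagonal d * Nᵀ) = fun i => ∑ r, (M i r * d r) • (Nᵀ r) := by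
      ext i j
      simp [Matrix.mul_apply, Matrix.diagonal_apply, Finset.sum_apply]
    have := (detRowAlternating (n := Fin m) (R := F)).toMultilinearMap.map_sum
      (fun (i : Fin m) (r : Fin n) => (M i r * d r) • (Nᵀ r))
    rw [e]
    refine Eq.trans this ?_
    refine Finset.sum_congr rfl fun f _ => ?_
    have h2 := (detRowAlternating (n := Fin m) (R := F)).toMultilinearMap.map_smul_univ
      (fun i => M i (f i) * d (f i)) (fun i => Nᵀ (f i))
    refine Eq.trans h2 ?_
    rw [smul_eq_mul]
    congr 1
    rw [← Matrix.det_transpose]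
    rfl
  have h3 : ∀ τ : Perm (Fin m), (M * diagonal d * Nᵀ).det =
      ∑ f : Fin m → Fin n, (∏ i, M i (f (τ i)) * d (f (τ i))) *
        (N.submatrix id (f ∘ τ)).det := by
    intro τ
    rw [h1]
    exact (Equiv.sum_comp (Equiv.arrowCongr τ.symm (Equiv.refl (Fin n)))
      (fun f : Fin m → Fin n => (∏ i, M i (f i) * d (f i)) * (N.submatrix id f).det)).symm
  have h4 : (m.factorial : F) * (M * diagonal d * Nᵀ).det =
      ∑ τ : Perm (Fin m), (M * diagonal d * Nᵀ).det := by
    simp [Finset.card_univ, Fintype.card_perm]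
  rw [h4, Finset.sum_congr rfl fun τ _ => h3 τ, Finset.sum_comm]
  refine Finset.sum_congr rfl fun f _ => ?_
  rw [← Matrix.det_transpose (M.submatrix id f), Matrix.det_apply', Finset.sum_mul, Finset.mul_sum]
  refine Finset.sum_congr rfl fun τ _ => ?_
  have h5 : (N.submatrix id (f ∘ τ)).det = ((Perm.sign τ : ℤ) : F) * (N.submatrix id f).det := by
    rw [← Matrix.det_permute']
    rfl
  rw [h5, Finset.prod_mul_distrib, Equiv.prod_comp τ (fun i => d (f i))]
  simp only [Matrix.transpose_apply, Matrix.submatrix_apply, id]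
  ring

/-- All `m`-minors of `A D Aᵀ` vanish implies `d̂ = 0`. -/
lemma aux_hat_zero {I R m : ℕ} (A : Matrix (Fin I) (Fin R) F)
    (h2 : FullColRank (khatriRao (compound m A) (compound m A)))
    (d : Fin R → F) (hr : (A * Matrix.diagonal d * Aᵀ).rank < m)
    (t : Finset (Fin R)) (ht : t.card = m) : ∏ i ∈ t, d i = 0 := by
  classical
  let cnt : {t : Finset (Fin R) // t.card = m} → ℕ := fun t =>
    (Finset.univ.filter fun f : Fin m → Fin R => Finset.univ.image f = t.1).card
  have key : ∀ t : {t : Finset (Fin R) // t.card = m}, (cnt t : F) * ∏ i ∈ t.1, d i = 0 := by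
    have := Fintype.linearIndependent_iff.1 h2 (fun t => (cnt t : F) * ∏ i ∈ t.1, d i)
    apply this
    ext ⟨s, s'⟩
    simp only [Finset.sum_apply, Pi.smul_apply, Matrix.transpose_apply, khatriRao, smul_eq_mul,
      Pi.zero_apply]
    set M : Matrix (Fin m) (Fin R) F := A.submatrix (fun i => (s.1.orderIsoOfFin s.2 i).1) id
      with hM
    set N : Matrix (Fin m) (Fin R) F := A.submatrix (fun i => (s'.1.orderIsoOfFin s'.2 i).1) id
      with hN
    have hdet : (M * Matrix.diagonal d * Nᵀ).det = 0 := by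
      by_contra hne
      have h1 := Matrix.rank_of_det_ne_zero hne
      have h3 : M * Matrix.diagonal d * Nᵀ = (A * Matrix.diagonal d * Aᵀ).submatrix
          (fun i => (s.1.orderIsoOfFin s.2 i).1) (fun i => (s'.1.orderIsoOfFin s'.2 i).1) := by
        ext i j
        simp [hM, hN, Matrix.mul_apply]
      rw [h3] at h1
      have h4 := Matrix.rank_submatrix_le (A * Matrix.diagonal d * Aᵀ)
        (fun i => (s.1.orderIsoOfFin s.2 i).1) (fun i => (s'.1.orderIsoOfFin s'.2 i).1)
      rw [Fintype.card_fin] at h1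
      omega
    have hg := aux_gram_det M N d
    rw [hdet, mul_zero] at hg
    rw [hg]
    -- group by image
    have hinj : ∀ f : Fin m → Fin R, ¬ Function.Injective f → (M.submatrix id f).det = 0 := by
      intro f hf
      simp only [Function.Injective, not_forall] at hf
      obtain ⟨i, j, hij, hne⟩ := hf
      exact Matrix.det_zero_of_column_eq hne (fun k => by simp [hij])
    have hval : ∀ t : {t : Finset (Fin R) // t.card = m}, ∀ f : Fin m → Fin R,
        Finset.univ.image f = t.1 →
        (∏ i, d (f i)) * ((M.submatrix id f).det * (N.submatrix id f).det) =
          (∏ i ∈ t.1, d i) * (compound m A s t * compound m A s' t) := by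
      intro t f hf
      have hfi : Function.Injective f := by
        have : (Finset.univ.image f).card = (Finset.univ : Finset (Fin m)).card := by
          rw [hf, t.2]; simp
        have h := Finset.card_image_iff.1 this
        intro a b hab
        exact h (by simp) (by simp) hab
      congr 1
      · rw [← hf, Finset.prod_image (fun a _ b _ h => hfi h)]
      · have hmem : ∀ i, f i ∈ t.1 := fun i => by rw [← hf]; simp
        let e := t.1.orderIsoOfFin t.2
        have hbij : Function.Bijective (fun i => e.symm ⟨f i, hmem i⟩) := by
          rw [← Finite.injective_iff_bijective]
          intro a b hab
          simpa [hfi.eq_iff] using hab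
        let τ : Equiv.Perm (Fin m) := Equiv.ofBijective _ hbij
        have hτ : ∀ i, f i = (e (τ i)).1 := fun i => by simp [τ]
        have hd : ∀ (P : Matrix (Fin m) (Fin R) F), (P.submatrix id f).det =
            ((Equiv.Perm.sign τ : ℤ) : F) * (P.submatrix id (fun i => (e i).1)).det := by
          intro P
          rw [← Matrix.det_permute']
          congr 1
          ext i j
          simp [hτ]
        rw [hd M, hd N]
        have hs : ((Equiv.Perm.sign τ : ℤ) : F) * ((Equiv.Perm.sign τ : ℤ) : F) = 1 := by
          rw [← Int.cast_mul, ← Units.val_mul, Int.units_mul_self]; simp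
        have e1 : (M.submatrix id (fun i => (e i).1)).det = compound m A s t := rfl
        have e2 : (N.submatrix id (fun i => (e i).1)).det = compound m A s' t := rfl
        rw [e1, e2]
        linear_combination (compound m A s t * compound m A s' t) * hs
    have hs1 : ∑ t : {t : Finset (Fin R) // t.card = m},
        (cnt t : F) * (∏ i ∈ t.1, d i) * (compound m A s t * compound m A s' t) =
        ∑ t : {t : Finset (Fin R) // t.card = m}, ∑ f : Fin m → Fin R with
          Finset.univ.image f = t.1,
          (∏ i, d (f i)) * ((M.submatrix id f).det * (N.submatrix id f).det) := by
      refine Finset.sum_congr rfl fun t _ => ?_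
      rw [Finset.sum_congr rfl (fun f hf => hval t f (Finset.mem_filter.1 hf).2)]
      simp [cnt, mul_assoc]
    rw [hs1]
    simp_rw [Finset.sum_filter]
    rw [Finset.sum_comm]
    refine Finset.sum_congr rfl fun f _ => ?_
    by_cases hf : Function.Injective f
    · have hc : (Finset.univ.image f).card = m := by
        rw [Finset.card_image_of_injective _ hf]; simp
      rw [Finset.sum_eq_single (⟨Finset.univ.image f, hc⟩ : {t : Finset (Fin R) // t.card = m})]
      · simp
      · intro b _ hb
        rw [if_neg]
        intro h
        exact hb (Subtype.ext h.symm)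
      · simp
    · simp [hinj f hf]
  have h := key ⟨t, ht⟩
  rcases mul_eq_zero.1 h with h | h
  · exfalso
    have h0 : cnt ⟨t, ht⟩ = 0 := by exact_mod_cast h
    have h1 := Finset.card_eq_zero.1 h0
    have : (fun i => (t.orderIsoOfFin ht i).1) ∈
        Finset.univ.filter fun f : Fin m → Fin R => Finset.univ.image f = t := by
      simp only [Finset.mem_filter, Finset.mem_univ, true_and]
      ext x
      simp only [Finset.mem_image, Finset.mem_univ, true_and]
      constructor
      · rintro ⟨i, rfl⟩; exact (t.orderIsoOfFin ht i).2
      · intro hx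
        exact ⟨(t.orderIsoOfFin ht).symm ⟨x, hx⟩, by simp⟩
    rw [h1] at this
    simp at this
  · exact h

/-- Any `m` columns are linearly independent. -/
lemma aux_indep_of_fcr {I R m : ℕ} (A : Matrix (Fin I) (Fin R) F)
    (h2 : FullColRank (khatriRao (compound m A) (compound m A)))
    (t : Finset (Fin R)) (ht : t.card = m) :
    LinearIndependent F (fun r : {x // x ∈ t} => A.transpose r.1) := by
  have h0 := h2.ne_zero ⟨t, ht⟩
  have : ∃ s, compound m A s ⟨t, ht⟩ ≠ 0 := by
    by_contra hc
    push Not at hc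
    apply h0
    ext ⟨s, s'⟩
    simp [khatriRao, hc]
  obtain ⟨s, hs⟩ := this
  let e := t.orderIsoOfFin ht
  suffices h : LinearIndependent F (fun i : Fin m => A.transpose (e i).1) by
    exact (linearIndependent_equiv e.toEquiv (f := fun r : {x // x ∈ t} => A.transpose r.1)).1 h
  have h3 := Matrix.linearIndependent_cols_of_det_ne_zero hs
  let P : (Fin I → F) →ₗ[F] (Fin m → F) :=
    LinearMap.funLeft F F (fun i => (s.1.orderIsoOfFin s.2 i).1)
  exact LinearIndependent.of_comp P h3

/-- monotonicity for subsets -/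
lemma aux_indep_mono {I R m : ℕ} (A : Matrix (Fin I) (Fin R) F) (hm : m ≤ R)
    (h : ∀ t : Finset (Fin R), t.card = m →
      LinearIndependent F (fun r : {x // x ∈ t} => A.transpose r.1))
    (u : Finset (Fin R)) (hu : u.card ≤ m) :
    LinearIndepOn F A.transpose (u : Set (Fin R)) := by
  obtain ⟨t, hut, -, ht⟩ := Finset.exists_subsuperset_card_eq (Finset.subset_univ u) hu
    (by simpa using hm)
  have h1 : LinearIndepOn F A.transpose (t : Set (Fin R)) := h t ht
  exact h1.mono (by exact_mod_cast hut)

lemma aux_krank {I R : ℕ} (A : Matrix (Fin I) (Fin R) F) : krank A ≤ R ∧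
    ∀ u : Finset (Fin R), u.card ≤ krank A → LinearIndepOn F A.transpose (u : Set (Fin R)) := by
  have hmem := Nat.sSup_mem (s := {k | k ≤ R ∧ ∀ s : Finset (Fin R), s.card = k →
    LinearIndependent F (fun r : {x // x ∈ s} => A.transpose r.1)})
    ⟨0, Nat.zero_le _, fun s hs => by
      have : IsEmpty {x // x ∈ s} := by
        rw [Finset.card_eq_zero] at hs; subst hs; infer_instance
      exact linearIndependent_empty_type⟩ ⟨R, fun k hk => hk.1⟩
  exact ⟨hmem.1, fun u hu => aux_indep_mono A hmem.1 hmem.2 u hu⟩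

lemma aux_dual {ι κ : Type*} [Fintype κ] (v : ι → κ → F) (s : Set ι)
    (h : LinearIndepOn F v s) (c : s → F) : ∃ y : κ → F, ∀ r : s, v r ⬝ᵥ y = c r := by
  classical
  obtain ⟨g, hg⟩ := LinearMap.exists_extend ((Finsupp.linearCombination F c).comp
    (LinearIndependent.repr h : _ →ₗ[F] _))
  refine ⟨fun k => g (Pi.single k 1), fun r => ?_⟩
  have h1 : g (v r) = c r := by
    have := LinearMap.congr_fun hg ⟨v r, Submodule.subset_span ⟨r, rfl⟩⟩
    simp only [LinearMap.comp_apply, Submodule.subtype_apply] at this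
    rw [this]
    have h2 := LinearIndependent.repr_eq_single h r ⟨v r, Submodule.subset_span ⟨r, rfl⟩⟩ rfl
    simp [h2]
  rw [← h1, LinearMap.pi_apply_eq_sum_univ g (v r)]
  simp only [dotProduct, smul_eq_mul]
  refine Finset.sum_congr rfl fun i _ => ?_
  congr 2
  ext j
  simp [Pi.single_apply, eq_comm]

/-- columns of support lie in the range of `A D Aᵀ`. -/
lemma aux_mem_range {I R : ℕ} (A : Matrix (Fin I) (Fin R) F) (d : Fin R → F)
    (h : LinearIndepOn F A.transpose {r | d r ≠ 0}) (r : Fin R) (hr : d r ≠ 0) :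
    A.transpose r ∈ LinearMap.range (A * Matrix.diagonal d * Aᵀ).mulVecLin := by
  classical
  obtain ⟨y, hy⟩ := aux_dual A.transpose _ h (fun s => if s.1 = r then (d r)⁻¹ else 0)
  refine ⟨y, ?_⟩
  rw [Matrix.mulVecLin_apply, ← Matrix.mulVec_mulVec, ← Matrix.mulVec_mulVec]
  have : Matrix.diagonal d *ᵥ (Aᵀ *ᵥ y) = Pi.single r 1 := by
    ext s
    rw [Matrix.mulVec_diagonal]
    by_cases hs : d s = 0
    · have : s ≠ r := fun h => hr (h ▸ hs)
      simp [hs, this]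
    · have := hy ⟨s, hs⟩
      change d s * (Aᵀ s ⬝ᵥ y) = _
      rw [this]
      by_cases hsr : s = r
      · subst hsr; simp [hs]
      · simp [hsr]
  rw [this]
  ext i
  simp

lemma aux_card_le_rank {I R : ℕ} (A : Matrix (Fin I) (Fin R) F) (d : Fin R → F)
    [DecidablePred fun r => d r ≠ 0]
    (h : LinearIndepOn F A.transpose {r | d r ≠ 0}) :
    (Finset.univ.filter fun r => d r ≠ 0).card ≤ (A * Matrix.diagonal d * Aᵀ).rank := by
  have h1 : Submodule.span F (Set.range fun r : {r | d r ≠ 0} => A.transpose r) ≤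
      LinearMap.range (A * Matrix.diagonal d * Aᵀ).mulVecLin := by
    rw [Submodule.span_le]
    rintro _ ⟨r, rfl⟩
    exact aux_mem_range A d h r r.2
  have h2 := Submodule.finrank_mono h1
  rw [finrank_span_eq_card h] at h2
  rw [← Fintype.card_subtype]
  exact h2

lemma aux_rank_le_card {I R : ℕ} (A : Matrix (Fin I) (Fin R) F) (d : Fin R → F)
    [DecidablePred fun r => d r ≠ 0] :
    (A * Matrix.diagonal d * Aᵀ).rank ≤ (Finset.univ.filter fun r => d r ≠ 0).card := by
  classical
  refine (Matrix.rank_mul_le_left _ _).trans ((Matrix.rank_mul_le_right _ _).trans ?_)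
  rw [Matrix.rank_diagonal, Fintype.card_subtype]

lemma aux_star {I R m : ℕ} (A : Matrix (Fin I) (Fin R) F) (hm : m ≤ R)
    (h2 : FullColRank (khatriRao (compound m A) (compound m A)))
    (d : Fin R → F) [DecidablePred fun r => d r ≠ 0]
    (hr : (A * Matrix.diagonal d * Aᵀ).rank < m) :
    (Finset.univ.filter fun r => d r ≠ 0).card ≤ (A * Matrix.diagonal d * Aᵀ).rank := by
  have hc : (Finset.univ.filter fun r => d r ≠ 0).card ≤ m := by
    by_contra hc
    obtain ⟨t, ht1, ht2⟩ := Finset.exists_subset_card_eq (not_le.1 hc).le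
    have := aux_hat_zero A h2 d hr t ht2
    rw [Finset.prod_eq_zero_iff] at this
    obtain ⟨i, hi, h0⟩ := this
    exact (Finset.mem_filter.1 (ht1 hi)).2 h0
  apply aux_card_le_rank
  have := aux_indep_mono A hm (fun t ht => aux_indep_of_fcr A h2 t ht) _ hc
  simpa using this

lemma aux_functional {K : ℕ} (g : (Fin K → F) →ₗ[F] F) :
    ∃ x : Fin K → F, ∀ v, x ⬝ᵥ v = g v := by
  classical
  refine ⟨fun k => g (Pi.single k 1), fun v => ?_⟩
  rw [LinearMap.pi_apply_eq_sum_univ g v]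
  simp only [dotProduct, smul_eq_mul]
  refine Finset.sum_congr rfl fun i _ => ?_
  rw [mul_comm]
  congr 2
  ext j
  simp [Pi.single_apply, eq_comm]

lemma aux_sep {K : ℕ} (W : Submodule F (Fin K → F)) (u : Fin K → F) (hu : u ∉ W) :
    ∃ x : Fin K → F, (∀ w ∈ W, x ⬝ᵥ w = 0) ∧ x ⬝ᵥ u ≠ 0 := by
  obtain ⟨g, hg1, hg2⟩ := Submodule.exists_le_ker_of_notMem hu
  obtain ⟨x, hx⟩ := aux_functional g
  refine ⟨x, fun w hw => ?_, ?_⟩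
  · rw [hx]; exact hg2 hw
  · rw [hx]; exact hg1

lemma aux_sup_span {E : Type*} [AddCommGroup E] [Module F E] [FiniteDimensional F E]
    (W V : Submodule F E) (hWV : W ≤ V)
    (hf : Module.finrank F V ≤ Module.finrank F W + 1) (v : E) (hv : v ∈ V) (hvW : v ∉ W) :
    W ⊔ Submodule.span F {v} = V := by
  have hle : W ⊔ Submodule.span F {v} ≤ V := sup_le hWV (by simpa using hv)
  apply Submodule.eq_of_le_of_finrank_le hle
  have hlt : W < W ⊔ Submodule.span F {v} := by
    refine lt_of_le_of_ne le_sup_left fun h => hvW ?_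
    rw [h]
    exact Submodule.mem_sup_right (Submodule.mem_span_singleton_self v)
  have := Submodule.finrank_lt_finrank_of_lt hlt
  omega

lemma aux_finrank_sup {E : Type*} [AddCommGroup E] [Module F E] [FiniteDimensional F E]
    (W : Submodule F E) (v : E) (hvW : v ∉ W) :
    Module.finrank F (W ⊔ Submodule.span F {v} : Submodule F E) = Module.finrank F W + 1 := by
  have hlt : W < W ⊔ Submodule.span F {v} := by
    refine lt_of_le_of_ne le_sup_left fun h => hvW ?_
    rw [h]
    exact Submodule.mem_sup_right (Submodule.mem_span_singleton_self v)
  have h1 := Submodule.finrank_lt_finrank_of_lt hlt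
  have h2 := Submodule.finrank_add_le_finrank_add_finrank W (Submodule.span F {v})
  have h3 := finrank_span_singleton (K := F) (v := v) (fun h => hvW (h ▸ W.zero_mem))
  omega

open Classical in
/-- The counting form of the Kruskal permutation lemma. -/
lemma aux_count {K R R' : ℕ} (c : Fin R → Fin K → F) (c' : Fin R' → Fin K → F)
    (hU : ∀ i, c i ∈ Submodule.span F (Set.range c'))
    (H : ∀ x : Fin K → F,
      (Finset.univ.filter fun j => x ⬝ᵥ c' j ≠ 0).card +
        Module.finrank F (Submodule.span F (Set.range c')) ≤ R' + 1 →
      (Finset.univ.filter fun i => x ⬝ᵥ c i ≠ 0).card ≤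
        (Finset.univ.filter fun j => x ⬝ᵥ c' j ≠ 0).card) :
    ∀ (n : ℕ) (S : Set (Fin R')) (W : Submodule F (Fin K → F)), W = Submodule.span F (c' '' S) →
      Module.finrank F W + n = Module.finrank F (Submodule.span F (Set.range c')) →
      (Finset.univ.filter fun j => c' j ∈ W).card + R ≤
        (Finset.univ.filter fun i => c i ∈ W).card + R' := by
  set U := Submodule.span F (Set.range c') with hUdef
  have hc'U : ∀ j, c' j ∈ U := fun j => Submodule.subset_span ⟨j, rfl⟩
  intro n
  induction n with
  | zero =>
    intro S W hW hn
    have hle : W ≤ U := by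
      rw [hW]; exact Submodule.span_mono (Set.image_subset_range _ _)
    have : W = U := Submodule.eq_of_le_of_finrank_le hle (by omega)
    have h1 : (Finset.univ.filter fun j => c' j ∈ W) = Finset.univ :=
      Finset.filter_true_of_mem fun j _ => this ▸ hc'U j
    have h2 : (Finset.univ.filter fun j => c j ∈ W) = Finset.univ :=
      Finset.filter_true_of_mem fun j _ => this ▸ hU j
    rw [h1, h2]
    simp [add_comm]
  | succ n ih =>
    intro S W hW hn
    have hle : W ≤ U := by
      rw [hW]; exact Submodule.span_mono (Set.image_subset_range _ _)
    rcases Nat.eq_zero_or_pos n with h0 | hpos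
    · subst h0
      have hex : ∃ u ∈ U, u ∉ W := by
        by_contra hc
        push Not at hc
        have := Submodule.finrank_mono (show U ≤ W from hc)
        omega
      obtain ⟨u, huU, huW⟩ := hex
      obtain ⟨x, hx1, hx2⟩ := aux_sep W u huW
      have hiff : ∀ v ∈ U, (x ⬝ᵥ v ≠ 0 ↔ v ∉ W) := by
        intro v hv
        refine ⟨fun h hvW => h (hx1 v hvW), fun hvW h => ?_⟩
        have h1 := aux_sup_span W U hle (by omega) v hv hvW
        have h2 : u ∈ W ⊔ Submodule.span F {v} := h1 ▸ huU
        obtain ⟨w, hw, z, hz, rfl⟩ := Submodule.mem_sup.1 h2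
        obtain ⟨a, rfl⟩ := Submodule.mem_span_singleton.1 hz
        apply hx2
        rw [dotProduct_add, dotProduct_smul, hx1 w hw, h]
        simp
      have e1 : (Finset.univ.filter fun j => x ⬝ᵥ c' j ≠ 0) =
          Finset.univ.filter fun j => ¬ (c' j ∈ W) :=
        Finset.filter_congr fun j _ => hiff _ (hc'U j)
      have e2 : (Finset.univ.filter fun j => x ⬝ᵥ c j ≠ 0) =
          Finset.univ.filter fun j => ¬ (c j ∈ W) :=
        Finset.filter_congr fun j _ => hiff _ (hU j)
      have f1 := Finset.card_filter_add_card_filter_not (s := (Finset.univ : Finset (Fin R')))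
        (fun j => c' j ∈ W)
      have f2 := Finset.card_filter_add_card_filter_not (s := (Finset.univ : Finset (Fin R)))
        (fun j => c j ∈ W)
      have f3 : Module.finrank F W ≤ (Finset.univ.filter fun j => c' j ∈ W).card := by
        have hWle : W ≤ Submodule.span F
            (((Finset.univ.filter fun j => c' j ∈ W).image c' : Finset (Fin K → F)) :
              Set (Fin K → F)) := by
          conv_lhs => rw [hW]
          apply Submodule.span_mono
          rintro _ ⟨j, hj, rfl⟩
          simp only [Finset.coe_image, Finset.coe_filter, Finset.mem_univ, true_and]
          refine ⟨j, ?_, rfl⟩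
          change c' j ∈ W
          rw [hW]
          exact Submodule.subset_span ⟨j, hj, rfl⟩
        exact (Submodule.finrank_mono hWle).trans
          ((finrank_span_finset_le_card _).trans Finset.card_image_le)
      have := H x
      rw [e1, e2] at this
      simp only [Finset.card_univ, Fintype.card_fin] at f1 f2
      have := this (by omega)
      omega
    · -- counting step
      let Vf : (Fin K → F) → Submodule F (Fin K → F) := fun v => W ⊔ Submodule.span F {v}
      let Q : Finset (Submodule F (Fin K → F)) :=
        (Finset.univ.filter fun j => c' j ∉ W).image fun j => Vf (c' j)
      have hQ : ∀ V ∈ Q, W ≤ V ∧ Module.finrank F V = Module.finrank F W + 1 ∧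
          (Finset.univ.filter fun j => c' j ∈ V).card + R ≤
            (Finset.univ.filter fun i => c i ∈ V).card + R' := by
        intro V hV
        obtain ⟨j, hj, rfl⟩ := Finset.mem_image.1 hV
        have hjW := (Finset.mem_filter.1 hj).2
        have hfr := aux_finrank_sup W (c' j) hjW
        refine ⟨le_sup_left, hfr, ?_⟩
        refine ih (insert j S) _ ?_ ?_
        · rw [Set.image_insert_eq, Submodule.span_insert, ← hW, sup_comm]
        · change Module.finrank F (W ⊔ Submodule.span F {c' j} : Submodule F _) + n = _
          omega
      have hVf : ∀ V ∈ Q, ∀ v, v ∉ W → (Vf v = V ↔ v ∈ V) := by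
        intro V hV v hv
        obtain ⟨h1, h2, -⟩ := hQ V hV
        constructor
        · intro h
          rw [← h]
          exact Submodule.mem_sup_right (Submodule.mem_span_singleton_self v)
        · intro h
          exact aux_sup_span W V h1 h2.le v h hv
      have hq : 1 < Q.card := by
        have hex : ∀ V : Submodule F (Fin K → F), Module.finrank F V ≤ Module.finrank F W + 1 →
            ∃ j, c' j ∉ V := by
          intro V hV
          by_contra hc
          push Not at hc
          have h1 : U ≤ V := by
            rw [hUdef, Submodule.span_le]
            rintro _ ⟨j, rfl⟩
            exact hc j
          have := Submodule.finrank_mono h1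
          omega
        obtain ⟨j0, hj0⟩ := hex W (by omega)
        obtain ⟨j1, hj1⟩ := hex (Vf (c' j0)) (aux_finrank_sup W _ hj0).le
        have hj1W : c' j1 ∉ W := fun h => hj1 ((le_sup_left : W ≤ Vf (c' j0)) h)
        rw [Finset.one_lt_card]
        refine ⟨Vf (c' j0), Finset.mem_image.2 ⟨j0, by simpa using hj0, rfl⟩,
          Vf (c' j1), Finset.mem_image.2 ⟨j1, by simpa using hj1W, rfl⟩, fun h => hj1 ?_⟩
        rw [h]
        exact Submodule.mem_sup_right (Submodule.mem_span_singleton_self _)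
      -- splitting counts
      have hsplit : ∀ {N : ℕ} (b : Fin N → Fin K → F), ∀ V ∈ Q,
          (Finset.univ.filter fun j => b j ∈ V).card =
            (Finset.univ.filter fun j => b j ∈ W).card +
            (Finset.univ.filter fun j => b j ∉ W ∧ Vf (b j) = V).card := by
        intro N b V hV
        rw [← Finset.card_filter_add_card_filter_not (s := Finset.univ.filter fun j => b j ∈ V)
          (fun j => b j ∈ W), Finset.filter_filter, Finset.filter_filter]
        congr 2
        · apply Finset.filter_congr
          intro j _
          exact ⟨fun h => h.2, fun h => ⟨(hQ V hV).1 h, h⟩⟩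
        · apply Finset.filter_congr
          intro j _
          constructor
          · rintro ⟨h1, h2⟩
            exact ⟨h2, (hVf V hV _ h2).2 h1⟩
          · rintro ⟨h1, h2⟩
            exact ⟨(hVf V hV _ h1).1 h2, h1⟩
      have hb : ∑ V ∈ Q, (Finset.univ.filter fun j => c' j ∉ W ∧ Vf (c' j) = V).card =
          (Finset.univ.filter fun j => c' j ∉ W).card := by
        rw [Finset.card_eq_sum_card_fiberwise (f := fun j => Vf (c' j)) (t := Q)
          (s := Finset.univ.filter fun j => c' j ∉ W)]
        · simp_rw [Finset.filter_filter]
        · intro j hj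
          exact Finset.mem_coe.2 (Finset.mem_image_of_mem _ hj)
      have ha : ∑ V ∈ Q, (Finset.univ.filter fun j => c j ∉ W ∧ Vf (c j) = V).card ≤
          (Finset.univ.filter fun j => c j ∉ W).card := by
        have h1 : ((Finset.univ.filter fun j => c j ∉ W).filter fun j => Vf (c j) ∈ Q).card ≤
          (Finset.univ.filter fun j => c j ∉ W).card := Finset.card_filter_le _ _
        refine le_trans (le_of_eq ?_) h1
        rw [Finset.card_eq_sum_card_fiberwise (f := fun j => Vf (c j)) (t := Q)]
        · refine Finset.sum_congr rfl fun V hV => ?_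
          congr 1
          ext j
          simp only [Finset.mem_filter, Finset.mem_univ, true_and]
          constructor
          · rintro ⟨h1, h2⟩
            exact ⟨⟨h1, h2 ▸ hV⟩, h2⟩
          · rintro ⟨⟨h1, -⟩, h2⟩
            exact ⟨h1, h2⟩
        · intro j hj
          exact (Finset.mem_filter.1 hj).2
      have hsum : ∑ V ∈ Q, ((Finset.univ.filter fun j => c' j ∈ W).card +
            (Finset.univ.filter fun j => c' j ∉ W ∧ Vf (c' j) = V).card + R) ≤
          ∑ V ∈ Q, ((Finset.univ.filter fun j => c j ∈ W).card +
            (Finset.univ.filter fun j => c j ∉ W ∧ Vf (c j) = V).card + R') := by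
        refine Finset.sum_le_sum fun V hV => ?_
        have := (hQ V hV).2.2
        rwa [hsplit c' V hV, hsplit c V hV] at this
      have f1 := Finset.card_filter_add_card_filter_not (s := (Finset.univ : Finset (Fin R')))
        (fun j => c' j ∈ W)
      have f2 := Finset.card_filter_add_card_filter_not (s := (Finset.univ : Finset (Fin R)))
        (fun j => c j ∈ W)
      simp only [Finset.card_univ, Fintype.card_fin] at f1 f2
      simp only [Finset.sum_add_distrib, Finset.sum_const, smul_eq_mul] at hsum
      rw [hb] at hsum
      generalize (Finset.univ.filter fun j => c' j ∈ W).card = N' at *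
      generalize (Finset.univ.filter fun j => c j ∈ W).card = N at *
      obtain ⟨q, hqe⟩ : ∃ q, Q.card = q + 2 := ⟨Q.card - 2, by omega⟩
      rw [hqe] at hsum
      by_contra hcon
      push Not at hcon
      have hm : (q + 1) * (N + R' + 1) ≤ (q + 1) * (N' + R) := Nat.mul_le_mul_left _ hcon
      nlinarith [hm, hsum, f1, f2, ha]

/-- the Kruskal permutation lemma. -/
lemma aux_perm {K R R' : ℕ} (c : Fin R → Fin K → F) (c' : Fin R' → Fin K → F) (hRR : R' ≤ R)
    (hc : ∀ i, c i ≠ 0)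
    (hpair : ∀ i i', i ≠ i' → LinearIndepOn F c ({i, i'} : Set (Fin R)))
    (hcount : ∀ (S : Set (Fin R')) (W : Submodule F (Fin K → F)),
      W = Submodule.span F (c' '' S) →
      {j | c' j ∈ W}.ncard + R ≤ {i | c i ∈ W}.ncard + R') :
    R' = R ∧ ∃ σ : Fin R' → Fin R, Function.Injective σ ∧
      ∃ l : Fin R' → F, ∀ j, l j ≠ 0 ∧ c' j = l j • c (σ j) := by
  have hR : R' = R := by
    have := hcount ∅ ⊥ (by simp)
    have h0 : {i | c i ∈ (⊥ : Submodule F (Fin K → F))} = ∅ := by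
      ext i; simp [hc]
    rw [h0] at this
    simp at this
    omega
  refine ⟨hR, ?_⟩
  have h1 : ∀ j, ∃ i, c i ∈ Submodule.span F {c' j} := by
    intro j
    have := hcount {j} (Submodule.span F {c' j}) (by simp)
    have hpos : 0 < {j' | c' j' ∈ Submodule.span F {c' j}}.ncard := by
      rw [Set.ncard_pos]
      exact ⟨j, Submodule.mem_span_singleton_self _⟩
    have hpos2 : 0 < {i | c i ∈ Submodule.span F {c' j}}.ncard := by omega
    rw [Set.ncard_pos] at hpos2
    exact hpos2
  have h2 : ∀ j, {j' | c' j' ∈ Submodule.span F {c' j}}.ncard ≤ 1 := by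
    intro j
    have := hcount {j} (Submodule.span F {c' j}) (by simp)
    have hle : {i | c i ∈ Submodule.span F {c' j}}.ncard ≤ 1 := by
      rw [Set.ncard_le_one]
      intro a ha b hb
      by_contra hab
      have hli := hpair a b hab
      have hcb := hc b
      obtain ⟨s, hs⟩ := Submodule.mem_span_singleton.1 ha
      obtain ⟨t, ht⟩ := Submodule.mem_span_singleton.1 hb
      rw [LinearIndepOn.pair_iff c hab] at hli
      have h3 := hli t (-s) (by rw [← hs, ← ht, smul_smul, smul_smul, mul_comm t s]; simp)
      apply hcb
      rw [← ht, h3.1, zero_smul]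
    omega
  choose σ hσ using h1
  have h3 : ∀ j, ∃ l : F, l ≠ 0 ∧ c' j = l • c (σ j) := by
    intro j
    obtain ⟨a, ha⟩ := Submodule.mem_span_singleton.1 (hσ j)
    have ha0 : a ≠ 0 := by
      rintro rfl
      exact hc (σ j) (by rw [← ha, zero_smul])
    exact ⟨a⁻¹, inv_ne_zero ha0, by rw [← ha, smul_smul, inv_mul_cancel₀ ha0, one_smul]⟩
  choose l hl using h3
  refine ⟨σ, fun j j' hjj => ?_, l, hl⟩
  have := h2 j
  rw [Set.ncard_le_one] at this
  refine this j (Submodule.mem_span_singleton_self _) j' ?_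
  change c' j' ∈ Submodule.span F {c' j}
  rw [(hl j').2, ← hjj]
  exact Submodule.smul_mem _ _ (hσ j)

lemma aux_finrank_image {I R : ℕ} (v : Fin R → Fin I → F) (p : Fin R → Prop) [DecidablePred p] :
    Module.finrank F (Submodule.span F (v '' {s | p s})) ≤ (Finset.univ.filter p).card := by
  classical
  have e2 : v '' {s | p s} =
      (((Finset.univ.filter p).image v : Finset (Fin I → F)) : Set (Fin I → F)) := by simp
  rw [e2]
  exact (finrank_span_finset_le_card _).trans Finset.card_image_le

lemma aux_span_fin {I R : ℕ} (v : Fin R → Fin I → F) (S : Finset (Fin R)) (w : Fin I → F)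
    (h : w ∈ Submodule.span F (v '' (S : Set (Fin R)))) :
    ∃ α : Fin R → F, ∑ i ∈ S, α i • v i = w :=
  (Submodule.mem_span_image_finset_iff_exists_fun' F).1 h

lemma aux_rank_two {K R : ℕ} (C : Matrix (Fin K) (Fin R) F) (h : 2 ≤ krank C) :
    2 ≤ C.rank := by
  obtain ⟨hkC, hC⟩ := aux_krank C
  have hCrk : C.rank = Module.finrank F (Submodule.span F (Set.range C.transpose)) :=
    Matrix.rank_eq_finrank_span_cols C
  obtain ⟨u, -, hu⟩ := Finset.exists_subset_card_eq
    (show 2 ≤ (Finset.univ : Finset (Fin R)).card by simp; omega)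
  have hli := hC u (by omega)
  have h3 := finrank_span_eq_card hli
  rw [hCrk]
  have h4 : Submodule.span F (Set.range fun x : (u : Set (Fin R)) => C.transpose x) ≤
      Submodule.span F (Set.range C.transpose) := by
    apply Submodule.span_mono
    rintro _ ⟨x, rfl⟩
    exact ⟨x, rfl⟩
  have h5 := Submodule.finrank_mono h4
  rw [h3] at h5
  simpa [hu] using h5

lemma aux_range_le {I R : ℕ} (A : Matrix (Fin I) (Fin R) F) (d : Fin R → F) :
    LinearMap.range (A * Matrix.diagonal d * Aᵀ).mulVecLin ≤
      Submodule.span F (A.transpose '' {r | d r ≠ 0}) := by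
  rintro _ ⟨y, rfl⟩
  have : (A * Matrix.diagonal d * Aᵀ).mulVecLin y =
      ∑ r, (d r * (Aᵀ *ᵥ y) r) • A.transpose r := by
    rw [Matrix.mulVecLin_apply, ← Matrix.mulVec_mulVec, ← Matrix.mulVec_mulVec]
    ext i
    simp only [Matrix.mulVec, dotProduct, Finset.sum_apply, Pi.smul_apply,
      smul_eq_mul, Matrix.transpose_apply]
    refine Finset.sum_congr rfl fun r _ => ?_
    rw [mul_comm]
    congr 1
    exact Matrix.mulVec_diagonal d _ r
  rw [this]
  refine Submodule.sum_mem _ fun r _ => ?_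
  by_cases hr : d r = 0
  · simp [hr]
  · exact Submodule.smul_mem _ _ (Submodule.subset_span ⟨r, hr, rfl⟩)

lemma aux_slice {I K R R' : ℕ} {T : Fin I → Fin I → Fin K → F}
    {A : Matrix (Fin I) (Fin R) F} {C : Matrix (Fin K) (Fin R) F}
    {A' : Matrix (Fin I) (Fin R') F} {C' : Matrix (Fin K) (Fin R') F}
    (h : T = pdTensor A A C) (h' : T = pdTensor A' A' C') (x : Fin K → F) :
    A * Matrix.diagonal (fun r => x ⬝ᵥ C.transpose r) * Aᵀ =
      A' * Matrix.diagonal (fun r => x ⬝ᵥ C'.transpose r) * A'ᵀ := by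
  have key : ∀ {N : ℕ} (B : Matrix (Fin I) (Fin N) F) (D : Matrix (Fin K) (Fin N) F)
      (_ : T = pdTensor B B D) (i j : Fin I),
      (B * Matrix.diagonal (fun r => x ⬝ᵥ D.transpose r) * Bᵀ) i j = ∑ k, x k * T i j k := by
    intro N B D hB i j
    rw [Matrix.mul_apply]
    simp only [Matrix.mul_diagonal, Matrix.transpose_apply, hB, pdTensor, dotProduct,
      Finset.mul_sum, Finset.sum_mul]
    rw [Finset.sum_comm]
    refine Finset.sum_congr rfl fun k _ => Finset.sum_congr rfl fun r _ => ?_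
    ring
  ext i j
  exact (key A C h i j).trans (key A' C' h' i j).symm

/-- The second step: uniqueness of the first factor once the third one is known. -/
lemma aux_first {I K R : ℕ} (A A' : Matrix (Fin I) (Fin R) F) (C C' : Matrix (Fin K) (Fin R) F)
    (h1 : krank A + krank C ≥ R + 2)
    (hs : ∀ x : Fin K → F, A * Matrix.diagonal (fun r => x ⬝ᵥ C.transpose r) * Aᵀ =
      A' * Matrix.diagonal (fun r => x ⬝ᵥ C'.transpose r) * A'ᵀ)
    (σ : Equiv.Perm (Fin R)) (l : Fin R → F)
    (hl : ∀ j, l j ≠ 0 ∧ C'.transpose j = l j • C.transpose (σ j)) (j : Fin R) :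
    ∃ μ : F, A'.transpose j = μ • A.transpose (σ j) := by
  classical
  obtain ⟨hkA, hA⟩ := aux_krank A
  obtain ⟨hkC, hC⟩ := aux_krank C
  obtain ⟨p, hp⟩ : ∃ p, p + krank C = R + 1 := ⟨R + 1 - krank C, by omega⟩
  set r := σ j with hr
  have claim : ∀ S : Finset (Fin R), r ∈ S → S.card = p →
      A'.transpose j ∈ Submodule.span F (A.transpose '' (S : Set (Fin R))) := by
    intro S hrS hSp
    have hcard : (insert r Sᶜ).card ≤ krank C := by
      rw [Finset.card_insert_of_notMem (by simpa using hrS), Finset.card_compl, hSp]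
      simp
      omega
    obtain ⟨x, hx⟩ := aux_dual C.transpose _ (hC _ hcard) (fun s => if s.1 = r then 1 else 0)
    have hx' : ∀ s ∈ insert r Sᶜ, x ⬝ᵥ C.transpose s = if s = r then 1 else 0 := by
      intro s hsm
      rw [dotProduct_comm]
      exact hx ⟨s, hsm⟩
    set d : Fin R → F := fun s => x ⬝ᵥ C.transpose s with hd
    set d' : Fin R → F := fun s => x ⬝ᵥ C'.transpose s with hd'
    have hdr : d r ≠ 0 := by
      have := hx' r (Finset.mem_insert_self _ _)
      simp only [hd, this]; simp
    have hdS : {s | d s ≠ 0} ⊆ (S : Set (Fin R)) := by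
      intro s hsd
      by_contra hsS
      apply hsd
      have h3 : s ≠ r := fun h => hsS (h ▸ hrS)
      have := hx' s (Finset.mem_insert_of_mem (by simpa using hsS))
      simpa [h3] using this
    have hdd : ∀ s, d' s = l s * d (σ s) := by
      intro s
      simp only [hd, hd', (hl s).2, dotProduct_smul, smul_eq_mul]
    have hind : LinearIndepOn F A.transpose {s | d s ≠ 0} := (hA S (by omega)).mono hdS
    have hM := hs x
    have hcardle := aux_card_le_rank A d hind
    have e1 : LinearMap.range (A * Matrix.diagonal d * Aᵀ).mulVecLin =
        Submodule.span F (A'.transpose '' {s | d' s ≠ 0}) := by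
      apply Submodule.eq_of_le_of_finrank_le
      · rw [hM]; exact aux_range_le A' d'
      · refine le_trans ?_ hcardle
        refine (aux_finrank_image A'.transpose (fun s => d' s ≠ 0)).trans ?_
        apply Finset.card_le_card_of_injOn σ
        · intro s hsm
          have : d' s ≠ 0 := (Finset.mem_filter.1 hsm).2
          rw [hdd] at this
          simpa using right_ne_zero_of_mul this
        · exact σ.injective.injOn
    have h5 : A'.transpose j ∈ Submodule.span F (A'.transpose '' {s | d' s ≠ 0}) := by
      refine Submodule.subset_span ⟨j, ?_, rfl⟩
      change d' j ≠ 0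
      rw [hdd]
      exact mul_ne_zero (hl j).1 hdr
    rw [← e1] at h5
    exact Submodule.span_mono (Set.image_mono hdS) (aux_range_le A d h5)
  obtain ⟨S, hS1, -, hS2⟩ := Finset.exists_subsuperset_card_eq (Finset.subset_univ {r})
    (show ({r} : Finset (Fin R)).card ≤ p by simp; omega) (show p ≤ _ by simp; omega)
  have hrS : r ∈ S := hS1 (Finset.mem_singleton_self r)
  obtain ⟨t, ht⟩ : ∃ t, t ∉ S := by
    by_contra hc
    push Not at hc
    have : S = Finset.univ := Finset.eq_univ_iff_forall.2 hc
    rw [this] at hS2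
    simp at hS2
    omega
  have hmem := claim S hrS hS2
  obtain ⟨α, hα⟩ := aux_span_fin _ S _ hmem
  have hz : ∀ s ∈ S, s ≠ r → α s = 0 := by
    intro s hsS hsr
    have hin : LinearIndepOn F A.transpose ((insert t S : Finset (Fin R)) : Set (Fin R)) :=
      hA _ (by rw [Finset.card_insert_of_notMem ht]; omega)
    obtain ⟨y, hy⟩ := aux_dual A.transpose _ hin (fun u => if u.1 = s then 1 else 0)
    have hy' : ∀ u ∈ insert t S, A.transpose u ⬝ᵥ y = if u = s then 1 else 0 :=
      fun u hu => hy ⟨u, hu⟩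
    have hts : t ≠ s := fun h => ht (h ▸ hsS)
    have hm2 := claim (insert t (S.erase s))
      (Finset.mem_insert_of_mem (Finset.mem_erase.2 ⟨hsr.symm, hrS⟩))
      (by
        rw [Finset.card_insert_of_notMem (fun h => ht (Finset.mem_of_mem_erase h)),
          Finset.card_erase_of_mem hsS]
        have := Finset.card_pos.2 ⟨s, hsS⟩
        omega)
    obtain ⟨β, hβ⟩ := aux_span_fin _ _ _ hm2
    have g1 : A'.transpose j ⬝ᵥ y = 0 := by
      rw [← hβ, sum_dotProduct]
      refine Finset.sum_eq_zero fun u hu => ?_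
      have hus : u ≠ s := by
        rcases Finset.mem_insert.1 hu with rfl | h
        · exact hts
        · exact Finset.ne_of_mem_erase h
      have huS : u ∈ insert t S := by
        rcases Finset.mem_insert.1 hu with rfl | h
        · exact Finset.mem_insert_self _ _
        · exact Finset.mem_insert_of_mem (Finset.mem_of_mem_erase h)
      rw [smul_dotProduct, hy' u huS]
      simp [hus]
    rw [← hα, sum_dotProduct, Finset.sum_eq_single s] at g1
    · rw [smul_dotProduct, hy' s (Finset.mem_insert_of_mem hsS)] at g1
      simpa using g1
    · intro u hu hus
      rw [smul_dotProduct, hy' u (Finset.mem_insert_of_mem hu)]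
      simp [hus]
    · intro h; exact absurd hsS h
  refine ⟨α r, ?_⟩
  rw [← hα, Finset.sum_eq_single r]
  · intro u hu hur
    rw [hz u hu hur, zero_smul]
  · intro h; exact absurd hrS h

lemma aux_core {I K R R' : ℕ} (T : Fin I → Fin I → Fin K → F)
    (A : Matrix (Fin I) (Fin R) F) (C : Matrix (Fin K) (Fin R) F)
    (hPD : IsSFSPD T A C)
    (h1 : krank A + krank C ≥ R + 2)
    (h2 : FullColRank (khatriRao (compound (R - C.rank + 2) A) (compound (R - C.rank + 2) A)))
    (hRR : R' ≤ R) (A' : Matrix (Fin I) (Fin R') F) (C' : Matrix (Fin K) (Fin R') F)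
    (hPD' : IsSFSPD T A' C') :
    R' = R ∧ ∃ σ : Fin R' → Fin R, Function.Injective σ ∧
      ∃ l : Fin R' → F, ∀ j, l j ≠ 0 ∧ C'.transpose j = l j • C.transpose (σ j) := by
  classical
  obtain ⟨hkA, hA⟩ := aux_krank A
  obtain ⟨hkC, hC⟩ := aux_krank C
  have hs := aux_slice hPD.2.2 hPD'.2.2
  have hrC : C.rank ≤ R := Matrix.rank_le_width C
  have hCrk : C.rank = Module.finrank F (Submodule.span F (Set.range C.transpose)) :=
    Matrix.rank_eq_finrank_span_cols C
  have hrC2 := aux_rank_two C (by omega)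
  have hm : R - C.rank + 2 ≤ R := by omega
  have hstar : ∀ x : Fin K → F,
      (Finset.univ.filter fun j => x ⬝ᵥ C'.transpose j ≠ 0).card < R - C.rank + 2 →
      (Finset.univ.filter fun i => x ⬝ᵥ C.transpose i ≠ 0).card ≤
        (Finset.univ.filter fun j => x ⬝ᵥ C'.transpose j ≠ 0).card := by
    intro x hx
    have g1 := aux_rank_le_card A' (fun r => x ⬝ᵥ C'.transpose r)
    rw [← hs x] at g1
    exact (aux_star A hm h2 (fun r => x ⬝ᵥ C.transpose r) (lt_of_le_of_lt g1 hx)).trans g1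
  have hU : ∀ i, C.transpose i ∈ Submodule.span F (Set.range C'.transpose) := by
    intro i
    by_contra hi
    obtain ⟨x, hx1, hx2⟩ := aux_sep _ _ hi
    have h0 : (Finset.univ.filter fun j => x ⬝ᵥ C'.transpose j ≠ 0) = ∅ := by
      apply Finset.filter_eq_empty_iff.2
      intro j _
      simpa using hx1 _ (Submodule.subset_span ⟨j, rfl⟩)
    have := hstar x (by rw [h0]; simp)
    rw [h0, Finset.card_empty, Nat.le_zero, Finset.card_eq_zero] at this
    exact Finset.filter_eq_empty_iff.1 this (Finset.mem_univ i) hx2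
  have hrank : C.rank ≤ Module.finrank F (Submodule.span F (Set.range C'.transpose)) := by
    rw [hCrk]
    apply Submodule.finrank_mono
    rw [Submodule.span_le]
    rintro _ ⟨i, rfl⟩
    exact hU i
  have hcnt := aux_count C.transpose C'.transpose hU (fun x hx => hstar x (by omega))
  refine aux_perm C.transpose C'.transpose hRR hPD.2.1 ?_ ?_
  · intro i i' hii
    have := hC {i, i'} (by rw [Finset.card_pair hii]; omega)
    simpa using this
  · intro S W hW
    have hle : W ≤ Submodule.span F (Set.range C'.transpose) := by
      rw [hW]; exact Submodule.span_mono (Set.image_subset_range _ _)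
    have hf := Submodule.finrank_mono hle
    have := hcnt (Module.finrank F (Submodule.span F (Set.range C'.transpose)) -
      Module.finrank F W) S W hW (by omega)
    rw [Set.ncard_eq_toFinset_card', Set.ncard_eq_toFinset_card']
    simpa using this

lemma aux_unique {I K R : ℕ} (T : Fin I → Fin I → Fin K → F)
    (A : Matrix (Fin I) (Fin R) F) (C : Matrix (Fin K) (Fin R) F)
    (hPD : IsSFSPD T A C)
    (h1 : krank A + krank C ≥ R + 2)
    (h2 : FullColRank (khatriRao (compound (R - C.rank + 2) A) (compound (R - C.rank + 2) A)))
    (A' : Matrix (Fin I) (Fin R) F) (C' : Matrix (Fin K) (Fin R) F)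
    (hPD' : IsSFSPD T A' C') :
    ∃ σ : Equiv.Perm (Fin R), ∃ la lc : Fin R → F,
      (∀ r, la r * la r * lc r = 1) ∧
      (∀ i r, A' i r = A i (σ r) * la r) ∧
      (∀ k r, C' k r = C k (σ r) * lc r) := by
  classical
  obtain ⟨-, σ', hσ', l, hl'⟩ := aux_core T A C hPD h1 h2 le_rfl A' C' hPD'
  let σ : Equiv.Perm (Fin R) := Equiv.ofBijective σ' (Finite.injective_iff_bijective.1 hσ')
  have hl : ∀ j, l j ≠ 0 ∧ C'.transpose j = l j • C.transpose (σ j) := hl'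
  have hs := aux_slice hPD.2.2 hPD'.2.2
  have hμ := aux_first A A' C C' h1 hs σ l hl
  choose μ hμ using hμ
  have hA' : ∀ i r, A' i r = A i (σ r) * μ r := by
    intro i r
    have := congrFun (hμ r) i
    simpa [mul_comm] using this
  have hC' : ∀ k r, C' k r = C k (σ r) * l r := by
    intro k r
    have := congrFun (hl r).2 k
    simpa [mul_comm] using this
  refine ⟨σ, μ, l, fun j => ?_, hA', hC'⟩
  obtain ⟨x, -, hx⟩ := aux_sep (⊥ : Submodule F (Fin K → F)) (C.transpose (σ j))
    (by simpa using hPD.2.1 (σ j))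
  set e : Fin R → F := fun r => (x ⬝ᵥ C.transpose r) *
    (1 - μ (σ.symm r) * μ (σ.symm r) * l (σ.symm r)) with he
  have hzero : A * Matrix.diagonal e * Aᵀ = 0 := by
    have hx2 := hs x
    ext i i'
    have h3 := congrFun (congrFun hx2 i) i'
    rw [Matrix.mul_apply, Matrix.mul_apply] at h3
    rw [Matrix.mul_apply]
    simp only [Matrix.mul_diagonal, Matrix.transpose_apply] at h3 ⊢
    rw [Matrix.zero_apply, ← sub_eq_zero.2 h3]
    rw [← Equiv.sum_comp σ (fun r => A i r * e r * A i' r),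
      ← Equiv.sum_comp σ (fun r => A i r * (x ⬝ᵥ C.transpose r) * A i' r),
      ← Finset.sum_sub_distrib]
    refine Finset.sum_congr rfl fun r _ => ?_
    have h4 : x ⬝ᵥ C'.transpose r = l r * (x ⬝ᵥ C.transpose (σ r)) := by
      rw [(hl r).2, dotProduct_smul, smul_eq_mul]
    rw [h4, hA', hA']
    simp only [he, Equiv.symm_apply_apply]
    ring
  have hkA := (aux_krank A).1
  have hkC := (aux_krank C).1
  have hrC2 := aux_rank_two C (by omega)
  have hrC : C.rank ≤ R := Matrix.rank_le_width C
  have hm : R - C.rank + 2 ≤ R := by omega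
  · have := aux_star A hm h2 e (by rw [hzero, Matrix.rank_zero]; omega)
    rw [hzero, Matrix.rank_zero, Nat.le_zero, Finset.card_eq_zero] at this
    have h0 := Finset.filter_eq_empty_iff.1 this (Finset.mem_univ (σ j))
    simp only [ne_eq, not_not, he, Equiv.symm_apply_apply] at h0
    rcases mul_eq_zero.1 h0 with h | h
    · exact absurd h hx
    · exact (sub_eq_zero.1 h).symm

end Helpers

/-- Proposition 4.9: uniqueness of the SFS-CPD. -/
theorem stmt_15 {I K R : ℕ} (T : Fin I → Fin I → Fin K → F)
    (A : Matrix (Fin I) (Fin R) F) (C : Matrix (Fin K) (Fin R) F)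
    (hPD : IsSFSPD T A C)
    (h1 : krank A + krank C ≥ R + 2)
    (h2 : FullColRank (khatriRao (compound (R - C.rank + 2) A) (compound (R - C.rank + 2) A))) :
    sfsRank T = R ∧ SFSCPDUnique T R := by
  refine ⟨?_, ?_⟩
  · apply le_antisymm
    · exact Nat.sInf_le ⟨A, C, hPD⟩
    · refine le_csInf ⟨R, A, C, hPD⟩ ?_
      rintro R' ⟨A', C', hPD'⟩
      by_contra hlt
      exact hlt (aux_core T A C hPD h1 h2 (not_le.1 hlt).le A' C' hPD').1.ge
  · intro A1 A2 C1 C2 hP1 hP2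
    obtain ⟨σ1, la1, lc1, hl1, hA1, hC1⟩ := aux_unique T A C hPD h1 h2 A1 C1 hP1
    obtain ⟨σ2, la2, lc2, hl2, hA2, hC2⟩ := aux_unique T A C hPD h1 h2 A2 C2 hP2
    have ha : ∀ r, la1 r ≠ 0 := fun r h => by simpa [h] using hl1 r
    have hc : ∀ r, lc1 r ≠ 0 := fun r h => by simpa [h] using hl1 r
    refine ⟨σ2.trans σ1.symm, fun r => la2 r / la1 (σ1.symm (σ2 r)),
      fun r => lc2 r / lc1 (σ1.symm (σ2 r)), fun r => ?_, fun i r => ?_, fun k r => ?_⟩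
    · have e1 := hl1 (σ1.symm (σ2 r))
      have e2 := hl2 r
      have := ha (σ1.symm (σ2 r))
      have := hc (σ1.symm (σ2 r))
      rw [div_mul_div_comm, div_mul_div_comm, e1, e2, div_one]
    · have := ha (σ1.symm (σ2 r))
      rw [hA2, hA1]
      simp only [Equiv.trans_apply, Equiv.apply_symm_apply]
      field_simp
    · have := hc (σ1.symm (σ2 r))
      rw [hC2, hC1]
      simp only [Equiv.trans_apply, Equiv.apply_symm_apply]
      field_simp
end

section
/- Let T = [A,A,C]_R with A ∈ F^{I×R}, C ∈ F^{K×R}, and set m_A := R − r_A + 2. Assume: (i) k_A + max(min(k_C − 1, k_A), min(k_C, k_A − 1)) ≥ R + 1; (ii) C_{m_A}(A)⊙C_{m_A}(C) has full column rank. Then the SFS-rank of T equals R and the SFS-CPD of T is unique. -/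
open scoped Matrix
open MeasureTheory

variable {F : Type*} [RCLike F]

theorem cauchyBinet_aux {m R : ℕ} (P : Matrix (Fin m) (Fin R) F) (Q : Matrix (Fin R) (Fin m) F) :
    (P * Q).det = ∑ u : {t : Finset (Fin R) // t.card = m},
      (Matrix.of fun i j : Fin m => P i (u.1.orderIsoOfFin u.2 j).1).det *
      (Matrix.of fun i j : Fin m => Q (u.1.orderIsoOfFin u.2 i).1 j).det := by
  classical
  have e1 : (P * Q).det = ∑ f : Fin m → Fin R, (∏ i, P i (f i)) *
      (Matrix.of fun i j : Fin m => Q (f i) j).det := by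
    have h1 : (P * Q) = fun i => ∑ r, P i r • Q r := by
      funext i j
      simp [Matrix.mul_apply, Finset.sum_apply]
    rw [h1]
    have := (Matrix.detRowAlternating (R := F) (n := Fin m)).toMultilinearMap.map_sum
      (fun i (r : Fin R) => P i r • Q r)
    refine this.trans (Finset.sum_congr rfl fun f _ => ?_)
    exact (Matrix.detRowAlternating (R := F) (n := Fin m)).toMultilinearMap.map_smul_univ
      (fun i => P i (f i)) (fun i => Q (f i))
  rw [e1]
  have e2 : ∀ u : {t : Finset (Fin R) // t.card = m},
      (Matrix.of fun i j : Fin m => P i (u.1.orderIsoOfFin u.2 j).1).det *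
      (Matrix.of fun i j : Fin m => Q (u.1.orderIsoOfFin u.2 i).1 j).det =
      ∑ σ : Equiv.Perm (Fin m), (∏ i, P i (u.1.orderIsoOfFin u.2 (σ i)).1) *
        (Matrix.of fun i j : Fin m => Q (u.1.orderIsoOfFin u.2 (σ i)).1 j).det := by
    intro u
    rw [← Matrix.det_transpose, Matrix.det_apply', Finset.sum_mul]
    refine Finset.sum_congr rfl fun σ _ => ?_
    have := Matrix.det_permute σ (Matrix.of fun i j : Fin m => Q (u.1.orderIsoOfFin u.2 i).1 j)
    have h2 : (Matrix.of fun i j : Fin m => Q (u.1.orderIsoOfFin u.2 (σ i)).1 j).det =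
      (Equiv.Perm.sign σ : F) * (Matrix.of fun i j : Fin m => Q (u.1.orderIsoOfFin u.2 i).1 j).det := by
      rw [← this]; rfl
    rw [h2]
    simp only [Matrix.transpose_apply, Matrix.of_apply]
    ring
  rw [Finset.sum_congr rfl fun u _ => e2 u, ← Fintype.sum_prod_type'
    (f := fun (u : {t : Finset (Fin R) // t.card = m}) (σ : Equiv.Perm (Fin m)) =>
    (∏ i, P i (u.1.orderIsoOfFin u.2 (σ i)).1) *
        (Matrix.of fun i j : Fin m => Q (u.1.orderIsoOfFin u.2 (σ i)).1 j).det)]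
  symm
  refine Finset.sum_of_injOn (fun p i => (p.1.1.orderIsoOfFin p.1.2 (p.2 i)).1) ?_ ?_ ?_ ?_
  · rintro ⟨⟨u, hu⟩, σ⟩ - ⟨⟨v, hv⟩, τ⟩ - h
    simp only at h
    have huv : u = v := by
      have key : ∀ (w : Finset (Fin R)) (hw : w.card = m) (ρ : Equiv.Perm (Fin m)) (x : Fin R),
          x ∈ w ↔ ∃ i, (w.orderIsoOfFin hw (ρ i)).1 = x := by
        intro w hw ρ x
        constructor
        · intro hx
          exact ⟨ρ.symm ((w.orderIsoOfFin hw).symm ⟨x, hx⟩), by simp⟩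
        · rintro ⟨i, rfl⟩
          exact (w.orderIsoOfFin hw (ρ i)).2
      ext x
      rw [key u hu σ, key v hv τ]
      constructor
      · rintro ⟨i, hi⟩; exact ⟨i, by rw [← hi]; exact (congrFun h i).symm⟩
      · rintro ⟨i, hi⟩; exact ⟨i, by rw [← hi]; exact (congrFun h i)⟩
    subst huv
    congr 1
    ext i
    have := congrFun h i
    have := (u.orderIsoOfFin hu).injective (Subtype.ext this)
    rw [this]
  · intro _ _; simp
  · intro f _ hf
    by_cases hinj : Function.Injective f
    · exfalso; apply hf
      have hc : (Finset.univ.image f).card = m := by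
        rw [Finset.card_image_of_injective _ hinj]; simp
      let g : Fin m → Fin m := fun i => ((Finset.univ.image f).orderIsoOfFin hc).symm
        ⟨f i, by simp⟩
      have hg : Function.Injective g := by
        intro i j hij
        have := ((Finset.univ.image f).orderIsoOfFin hc).symm.injective hij
        exact hinj (by simpa using this)
      refine ⟨(⟨_, hc⟩, Equiv.ofBijective g (Finite.injective_iff_bijective.1 hg)), by simp, ?_⟩
      funext i
      simp [g]
    · simp only [Function.Injective, not_forall] at hinj
      obtain ⟨i, j, hij, hne⟩ := hinj
      rw [Matrix.det_zero_of_row_eq hne (by funext k; simp [hij]), mul_zero]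
  · intro p _
    rfl

open Module in
open scoped Classical in
theorem flat_count {V : Type*} [AddCommGroup V] [Module F V] [FiniteDimensional F V] {R R' m : ℕ}
    (a : Fin R → V) (b : Fin R' → V) (hR : R' ≤ R)
    (hm : R + 2 ≤ m + finrank F (Submodule.span F (Set.range a))) (hm1 : 1 ≤ m)
    (h : ∀ f : Module.Dual F V, (Finset.univ.filter fun r => f (b r) ≠ 0).card + 1 ≤ m →
      (Finset.univ.filter fun r => f (a r) ≠ 0).card ≤
        (Finset.univ.filter fun r => f (b r) ≠ 0).card) :
    ∀ (n : ℕ) (U : Submodule F V), finrank F (Submodule.span F (Set.range b)) = finrank F U + n →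
      (∃ J : Finset (Fin R'), U = Submodule.span F (b '' J)) →
      (Finset.univ.filter fun r => b r ∈ U).card + R ≤
        (Finset.univ.filter fun r => a r ∈ U).card + R' := by
  set S := Submodule.span F (Set.range b) with hS
  have haS : ∀ r, a r ∈ S := by
    intro r
    by_contra hr
    obtain ⟨f, hf, hfS⟩ := Submodule.exists_dual_map_eq_bot_of_notMem (R := F) hr inferInstance
    have hb0 : ∀ r, f (b r) = 0 := by
      intro s
      have : f (b s) ∈ S.map f := Submodule.mem_map_of_mem (Submodule.subset_span ⟨s, rfl⟩)
      rw [hfS] at this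
      exact (Submodule.mem_bot F).1 this
    have := h f (by simp [hb0, hm1])
    simp only [hb0, ne_eq, not_true_eq_false, Finset.filter_false, Finset.card_empty,
      nonpos_iff_eq_zero, Finset.card_eq_zero] at this
    have h2 : r ∈ (Finset.univ.filter fun r => f (a r) ≠ 0) := by simp [hf]
    simp [this] at h2
  have hbS : ∀ r, b r ∈ S := fun r => Submodule.subset_span ⟨r, rfl⟩
  have hrank : finrank F (Submodule.span F (Set.range a)) ≤ finrank F S := by
    apply Submodule.finrank_mono
    rw [Submodule.span_le]
    rintro _ ⟨r, rfl⟩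
    exact haS r
  intro n
  induction n with
  | zero =>
    rintro U hU ⟨J, hJ⟩
    have hle : U ≤ S := by
      rw [hJ, hS]; exact Submodule.span_mono (Set.image_subset_range _ _)
    have : U = S := Submodule.eq_of_le_of_finrank_eq hle (by omega)
    subst this
    simp [haS, hbS]
    omega
  | succ n ih =>
    rintro U hU ⟨J, hJ⟩
    have hle : U ≤ S := by
      rw [hJ, hS]; exact Submodule.span_mono (Set.image_subset_range _ _)
    have hbW : ∀ x, x ∉ U → finrank F (U ⊔ Submodule.span F {x} : Submodule F V) = finrank F U + 1 := by
      intro x hx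
      exact Submodule.finrank_sup_span_singleton hx
    have hexb : ∀ W : Submodule F V, finrank F W < finrank F S → ∃ r, b r ∉ W := by
      intro W hW
      by_contra hcon
      push Not at hcon
      have : S ≤ W := by
        rw [hS, Submodule.span_le]; rintro _ ⟨r, rfl⟩; exact hcon r
      have := Submodule.finrank_mono this
      omega
    have hWeq : ∀ (x y : V), x ∉ U → y ∉ U → y ∈ U ⊔ Submodule.span F {x} →
        U ⊔ Submodule.span F {y} = U ⊔ Submodule.span F {x} := by
      intro x y hx hy hxy
      apply Submodule.eq_of_le_of_finrank_eq
      · refine sup_le le_sup_left ?_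
        rw [Submodule.span_singleton_le_iff_mem]; exact hxy
      · rw [hbW x hx, hbW y hy]
    rcases Nat.eq_zero_or_pos n with hn | hn
    · subst hn
      obtain ⟨j, hj⟩ := hexb U (by omega)
      obtain ⟨f, hf, hfU⟩ := Submodule.exists_dual_map_eq_bot_of_notMem (R := F) hj inferInstance
      have hf0 : ∀ x ∈ U, f x = 0 := by
        intro x hx
        have : f x ∈ U.map f := Submodule.mem_map_of_mem hx
        rw [hfU] at this
        exact (Submodule.mem_bot F).1 this
      have hSW : U ⊔ Submodule.span F {b j} = S := by
        apply Submodule.eq_of_le_of_finrank_eq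
        · refine sup_le hle ?_
          rw [Submodule.span_singleton_le_iff_mem]; exact hbS j
        · rw [hbW _ hj]; omega
      have hiff : ∀ x ∈ S, (f x = 0 ↔ x ∈ U) := by
        intro x hx
        refine ⟨fun hfx => ?_, hf0 x⟩
        by_contra hxU
        have h3 := hWeq _ _ hj hxU (by rw [hSW]; exact hx)
        have h4 : b j ∈ U ⊔ Submodule.span F {x} := by rw [h3, hSW]; exact hbS j
        have h5 : U ⊔ Submodule.span F {x} ≤ LinearMap.ker f := by
          refine sup_le (fun y hy => hf0 y hy) ?_
          rw [Submodule.span_singleton_le_iff_mem]; exact hfx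
        exact hf (h5 h4)
      have hca := Finset.card_filter_add_card_filter_not (s := (Finset.univ : Finset (Fin R))) (fun r => a r ∈ U)
      have hcb := Finset.card_filter_add_card_filter_not (s := (Finset.univ : Finset (Fin R'))) (fun r => b r ∈ U)
      simp only [Finset.card_univ, Fintype.card_fin] at hca hcb
      have hfin : finrank F U ≤ (Finset.univ.filter fun r => b r ∈ U).card := by
        have h6 : finrank F U ≤ J.card := by
          rw [hJ, ← Finset.coe_image]
          exact (finrank_span_finset_le_card _).trans Finset.card_image_le
        refine h6.trans (Finset.card_le_card fun r hr => ?_)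
        simp only [Finset.mem_filter, Finset.mem_univ, true_and]
        rw [hJ]; exact Submodule.subset_span ⟨r, hr, rfl⟩
      have hb' : (Finset.univ.filter fun r => f (b r) ≠ 0) = (Finset.univ.filter fun r => ¬ b r ∈ U) := by
        apply Finset.filter_congr; intro r _; rw [ne_eq, hiff _ (hbS r)]
      have ha' : (Finset.univ.filter fun r => f (a r) ≠ 0) = (Finset.univ.filter fun r => ¬ a r ∈ U) := by
        apply Finset.filter_congr; intro r _; rw [ne_eq, hiff _ (haS r)]
      have := h f
      rw [hb', ha'] at this
      have := this (by omega)
      omega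
    · set N := Finset.univ.filter fun r => ¬ b r ∈ U with hN
      set g : Fin R' → Submodule F V := fun r => U ⊔ Submodule.span F {b r} with hg
      set W := N.image g with hW
      set p := (Finset.univ.filter fun r => b r ∈ U).card with hp
      set s := (Finset.univ.filter fun r => a r ∈ U).card with hs
      have hca := Finset.card_filter_add_card_filter_not (s := (Finset.univ : Finset (Fin R))) (fun r => a r ∈ U)
      have hcb := Finset.card_filter_add_card_filter_not (s := (Finset.univ : Finset (Fin R'))) (fun r => b r ∈ U)
      simp only [Finset.card_univ, Fintype.card_fin] at hca hcb
      rw [← hp, ← hN] at hcb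
      rw [← hs] at hca
      have hNsum : N.card = ∑ w ∈ W, (N.filter fun r => g r = w).card :=
        Finset.card_eq_sum_card_image g N
      have hMsum : ∑ w ∈ W, ((Finset.univ.filter fun r => ¬ a r ∈ U).filter
          fun r => U ⊔ Submodule.span F {a r} = w).card ≤ (Finset.univ.filter fun r => ¬ a r ∈ U).card := by
        rw [← Finset.card_biUnion]
        · apply Finset.card_le_card
          intro r hr
          simp only [Finset.mem_biUnion, Finset.mem_filter] at hr ⊢
          obtain ⟨_, _, h, _⟩ := hr
          exact h
        · intro w _ w' _ hww
          rw [Function.onFun, Finset.disjoint_left]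
          intro r hr hr'
          simp only [Finset.mem_filter] at hr hr'
          exact hww (hr.2.symm.trans hr'.2)
      have hstep : ∀ w ∈ W, (N.filter fun r => g r = w).card + p + R ≤
          ((Finset.univ.filter fun r => ¬ a r ∈ U).filter
          fun r => U ⊔ Submodule.span F {a r} = w).card + s + R' := by
        intro w hw
        obtain ⟨j, hj, rfl⟩ := Finset.mem_image.1 hw
        have hjU : b j ∉ U := by simpa [hN] using hj
        have hi := ih (g j) (by rw [hg]; simp only; rw [hbW _ hjU]; omega)
          ⟨insert j J, by
            rw [hg]; simp only
            rw [Finset.coe_insert, Set.image_insert_eq, Submodule.span_insert, ← hJ, sup_comm]⟩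
        have split : ∀ {Q : ℕ} (c : Fin Q → V), (Finset.univ.filter fun r => c r ∈ g j).card =
            ((Finset.univ.filter fun r => ¬ c r ∈ U).filter
              fun r => U ⊔ Submodule.span F {c r} = g j).card +
            (Finset.univ.filter fun r => c r ∈ U).card := by
          intro Q c
          rw [← Finset.card_filter_add_card_filter_not (s := Finset.univ.filter fun r => c r ∈ g j)
            (fun r => c r ∈ U), add_comm]
          congr 2
          · ext r
            simp only [Finset.mem_filter, Finset.mem_univ, true_and]
            constructor
            · rintro ⟨h1, h2⟩
              exact ⟨h2, hWeq _ _ hjU h2 h1⟩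
            · rintro ⟨h1, h2⟩
              refine ⟨?_, h1⟩
              rw [← h2]
              exact Submodule.mem_sup_right (Submodule.mem_span_singleton_self _)
          · ext r
            simp only [Finset.mem_filter, Finset.mem_univ, true_and]
            exact ⟨fun h => h.2, fun h => ⟨Submodule.mem_sup_left h, h⟩⟩
        rw [split a, split b] at hi
        simp only [← hp, ← hs, ← hN] at hi
        simp only [hg] at hi ⊢
        omega
      have hW2 : 2 ≤ W.card := by
        obtain ⟨j, hj⟩ := hexb U (by omega)
        obtain ⟨k, hk⟩ := hexb (g j) (by rw [hg]; simp only; rw [hbW _ hj]; omega)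
        have hkU : b k ∉ U := fun hc => hk (Submodule.mem_sup_left hc)
        have : ({g j, g k} : Finset _) ⊆ W := by
          intro x hx
          simp only [Finset.mem_insert, Finset.mem_singleton] at hx
          rcases hx with rfl | rfl
          · exact Finset.mem_image_of_mem _ (by simpa [hN] using hj)
          · exact Finset.mem_image_of_mem _ (by simpa [hN] using hkU)
        have h2 := Finset.card_le_card this
        rw [Finset.card_pair] at h2
        · exact h2
        · intro he
          apply hk
          rw [he]
          exact Submodule.mem_sup_right (Submodule.mem_span_singleton_self _)
      have htot := Finset.sum_le_sum hstep
      simp only [Finset.sum_add_distrib, Finset.sum_const, smul_eq_mul] at htot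
      rw [← hNsum] at htot
      generalize (Finset.univ.filter fun r => ¬ a r ∈ U).card = M at *
      have : N.card + W.card * p + W.card * R ≤ M + W.card * s + W.card * R' := by omega
      generalize W.card = q at *
      obtain ⟨q', rfl⟩ : ∃ q', q = q' + 2 := ⟨q - 2, by omega⟩
      by_contra hcon
      push Not at hcon
      nlinarith

open Module in
open scoped Classical in
theorem perm_lemma {V : Type*} [AddCommGroup V] [Module F V] [FiniteDimensional F V] {R R' m : ℕ}
    (a : Fin R → V) (b : Fin R' → V) (hR : R' ≤ R)
    (hm : R + 2 ≤ m + finrank F (Submodule.span F (Set.range a))) (hm1 : 1 ≤ m)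
    (h : ∀ f : Module.Dual F V, (Finset.univ.filter fun r => f (b r) ≠ 0).card + 1 ≤ m →
      (Finset.univ.filter fun r => f (a r) ≠ 0).card ≤
        (Finset.univ.filter fun r => f (b r) ≠ 0).card)
    (ha0 : ∀ r, a r ≠ 0) (ha : ∀ r s (c : F), a r = c • a s → r = s) :
    R' = R ∧ ∃ σ : Fin R' → Fin R, Function.Injective σ ∧ ∃ l : Fin R' → F,
      ∀ r, b r = l r • a (σ r) := by
  have key := flat_count a b hR hm hm1 h
  have hRR : R' = R := by
    have := key _ ⊥ (by rw [finrank_bot, zero_add]) ⟨∅, by simp⟩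
    simp only [Submodule.mem_bot, ha0, Finset.filter_false, Finset.card_empty] at this
    omega
  refine ⟨hRR, ?_⟩
  have hk : ∀ j, (Finset.univ.filter fun r => b r ∈ Submodule.span F {b j}).card ≤
      (Finset.univ.filter fun r => a r ∈ Submodule.span F {b j}).card := by
    intro j
    have hle : finrank F (Submodule.span F {b j}) ≤ finrank F (Submodule.span F (Set.range b)) :=
      Submodule.finrank_mono (Submodule.span_mono (by simp))
    have := key (finrank F (Submodule.span F (Set.range b)) - finrank F (Submodule.span F {b j}))
      (Submodule.span F {b j}) (by omega) ⟨{j}, by simp⟩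
    omega
  have h1 : ∀ j, (Finset.univ.filter fun r => a r ∈ Submodule.span F {b j}).card ≤ 1 := by
    intro j
    rw [Finset.card_le_one]
    intro r hr s hs
    simp only [Finset.mem_filter, Finset.mem_univ, true_and, Submodule.mem_span_singleton] at hr hs
    obtain ⟨x, hx⟩ := hr
    obtain ⟨y, hy⟩ := hs
    have hy0 : y ≠ 0 := by
      rintro rfl; exact ha0 s (by rw [← hy, zero_smul])
    refine ha r s (x / y) ?_
    rw [← hx, ← hy, smul_smul, div_mul_cancel₀ _ hy0]
  have hb1 : ∀ j k, b k ∈ Submodule.span F {b j} → k = j := by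
    intro j k hkj
    refine Finset.card_le_one.1 ((hk j).trans (h1 j)) k (by simpa using hkj) j ?_
    simp
  have hex : ∀ j, ∃ r, a r ∈ Submodule.span F {b j} := by
    intro j
    have : 0 < (Finset.univ.filter fun r => b r ∈ Submodule.span F {b j}).card :=
      Finset.card_pos.2 ⟨j, by simp⟩
    obtain ⟨r, hr⟩ := Finset.card_pos.1 (this.trans_le (hk j))
    exact ⟨r, by simpa using hr⟩
  choose σ hσ using hex
  have hl : ∀ j, ∃ c : F, b j = c • a (σ j) := by
    intro j
    obtain ⟨x, hx⟩ := Submodule.mem_span_singleton.1 (hσ j)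
    have hx0 : x ≠ 0 := by
      rintro rfl; exact ha0 (σ j) (by rw [← hx, zero_smul])
    exact ⟨x⁻¹, by rw [← hx, smul_smul, inv_mul_cancel₀ hx0, one_smul]⟩
  choose l hl using hl
  refine ⟨σ, ?_, l, hl⟩
  intro j k hjk
  apply hb1 k j
  rw [hl j, hjk]
  exact Submodule.smul_mem _ _ (hσ k)

theorem exists_dual_of_indep {V ι : Type*} [AddCommGroup V] [Module F V] {v : ι → V} {s : Set ι}
    (h : LinearIndepOn F v s) {j : ι} (hj : j ∈ s) :
    ∃ f : Module.Dual F V, f (v j) = 1 ∧ ∀ i ∈ s, i ≠ j → f (v i) = 0 := by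
  have hn : v j ∉ Submodule.span F (v '' (s \ {j})) := by
    rw [linearIndepOn_iff_notMem_span] at h
    exact h j hj
  obtain ⟨f, hf, hfS⟩ := Submodule.exists_dual_map_eq_bot_of_notMem (R := F) hn inferInstance
  refine ⟨(f (v j))⁻¹ • f, by simp [hf], fun i hi hij => ?_⟩
  have : f (v i) ∈ (Submodule.span F (v '' (s \ {j}))).map f :=
    Submodule.mem_map_of_mem (Submodule.subset_span ⟨i, ⟨hi, hij⟩, rfl⟩)
  rw [hfS] at this
  have : f (v i) = 0 := by simpa using this
  simp [this]

theorem kr_inj {V : Type*} [AddCommGroup V] [Module F V] {R k : ℕ} (a : Fin R → V) (hk1 : k ≤ R)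
    (hk2 : R + 1 ≤ k + k)
    (hind : ∀ s : Finset (Fin R), s.card ≤ k → LinearIndepOn F a (s : Set (Fin R)))
    (e : Fin R → F) (he : ∀ f : Module.Dual F V, ∑ r, (e r * f (a r)) • a r = 0) (j : Fin R) :
    e j = 0 := by
  classical
  obtain ⟨J, hJ1, -, hJ2⟩ := Finset.exists_subsuperset_card_eq (n := k)
    (Finset.subset_univ ({j} : Finset (Fin R))) (by simp; omega) (by simpa using hk1)
  have hjJ : j ∈ J := hJ1 (by simp)
  obtain ⟨f, hf1, hf0⟩ := exists_dual_of_indep (hind J hJ2.le) (j := j) (by simpa using hjJ)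
  have hf := he f
  have hc : (insert j (Finset.univ \ J)).card ≤ k := by
    refine (Finset.card_insert_le _ _).trans ?_
    rw [Finset.card_sdiff_of_subset (Finset.subset_univ _), hJ2, Finset.card_univ, Fintype.card_fin]
    omega
  have hs : ∑ r ∈ insert j (Finset.univ \ J), (e r * f (a r)) • a r = 0 := by
    rw [← hf]
    apply Finset.sum_subset (Finset.subset_univ _)
    intro r _ hr
    simp only [Finset.mem_insert, Finset.mem_sdiff, Finset.mem_univ, true_and, not_or,
      not_not] at hr
    rw [hf0 r (by simpa using hr.2) hr.1]; simp
  have := linearIndepOn_finset_iff.1 (hind _ hc) _ hs j (by simp)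
  simpa [hf1] using this

theorem rank_weight {V W : Type*} [AddCommGroup V] [Module F V] [AddCommGroup W] [Module F W]
    {R R' : ℕ} (a : Fin R → V) (c : Fin R → W) (a' : Fin R' → V) (c' : Fin R' → W)
    (d : Fin R → F) (d' : Fin R' → F) (s : Finset (Fin R)) (s' : Finset (Fin R'))
    (hs : ∀ r, r ∉ s → d r = 0) (hs0 : ∀ r ∈ s, d r ≠ 0) (hs' : ∀ r, r ∉ s' → d' r = 0)
    (ha : LinearIndepOn F a (s : Set (Fin R))) (hc : LinearIndepOn F c (s : Set (Fin R)))
    (h : ∀ g : Module.Dual F W, ∑ r, (d r * g (c r)) • a r = ∑ r, (d' r * g (c' r)) • a' r) :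
    s.card ≤ s'.card := by
  classical
  have hmem : ∀ r ∈ s, a r ∈ Submodule.span F (s'.image a' : Set V) := by
    intro r hr
    obtain ⟨g, hg1, hg0⟩ := exists_dual_of_indep hc (j := r) (by simpa using hr)
    have h1 := h g
    rw [Finset.sum_eq_single r] at h1
    · rw [hg1, mul_one] at h1
      have : a r = (d r)⁻¹ • ∑ r, (d' r * g (c' r)) • a' r := by
        rw [← h1, smul_smul, inv_mul_cancel₀ (hs0 r hr), one_smul]
      rw [this]
      refine Submodule.smul_mem _ _ (Submodule.sum_mem _ fun t _ => ?_)
      by_cases ht : t ∈ s'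
      · exact Submodule.smul_mem _ _ (Submodule.subset_span
          (Finset.mem_coe.2 (Finset.mem_image_of_mem _ ht)))
      · rw [hs' t ht]; simp
    · intro t _ ht
      by_cases hts : t ∈ s
      · rw [hg0 t (by simpa using hts) ht]; simp
      · rw [hs t hts]; simp
    · simp
  have h2 : Module.finrank F (Submodule.span F (a '' (s : Set (Fin R)))) = s.card := by
    have := finrank_span_eq_card (R := F) (b := fun r : (s : Set (Fin R)) => a r) ha
    rw [Set.image_eq_range, this]; simp
  rw [← h2]
  calc _ ≤ Module.finrank F (Submodule.span F (s'.image a' : Set V)) := by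
        apply Submodule.finrank_mono
        rw [Submodule.span_le]
        rintro _ ⟨r, hr, rfl⟩
        exact hmem r (by simpa using hr)
    _ ≤ (s'.image a').card := finrank_span_finset_le_card _
    _ ≤ _ := Finset.card_image_le

theorem krank_mem {I R : ℕ} (A : Matrix (Fin I) (Fin R) F) :
    krank A ∈ {k | k ≤ R ∧ ∀ s : Finset (Fin R), s.card = k →
    LinearIndependent F (fun r : {x // x ∈ s} => A.transpose r.1)} := by
  apply Nat.sSup_mem
  · refine ⟨0, Nat.zero_le _, fun s hs => ?_⟩
    rw [Finset.card_eq_zero] at hs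
    subst hs
    exact linearIndependent_empty_type
  · exact ⟨R, fun k hk => hk.1⟩

theorem indep_extend {V : Type*} [AddCommGroup V] [Module F V] {R k : ℕ} (a : Fin R → V)
    (hk : k ≤ R) (h : ∀ s : Finset (Fin R), s.card = k → LinearIndepOn F a (s : Set (Fin R)))
    (s : Finset (Fin R)) (hs : s.card ≤ k) : LinearIndepOn F a (s : Set (Fin R)) := by
  obtain ⟨J, hJ1, -, hJ2⟩ := Finset.exists_subsuperset_card_eq (n := k)
    (Finset.subset_univ s) hs (by simpa using hk)
  exact (h J hJ2).mono (by simpa using hJ1)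

theorem krank_indep {I R : ℕ} (A : Matrix (Fin I) (Fin R) F) (s : Finset (Fin R))
    (hs : s.card ≤ krank A) : LinearIndepOn F A.transpose (s : Set (Fin R)) :=
  indep_extend _ (krank_mem A).1 (fun s hs => (krank_mem A).2 s hs) s hs

theorem compound_indep {I R m : ℕ} (A : Matrix (Fin I) (Fin R) F)
    (s : {s : Finset (Fin I) // s.card = m}) (t : {t : Finset (Fin R) // t.card = m})
    (h : compound m A s t ≠ 0) : LinearIndepOn F A.transpose (t.1 : Set (Fin R)) := by
  have h1 := Matrix.linearIndependent_cols_of_det_ne_zero h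
  have h2 : LinearIndependent F (fun j : Fin m => A.transpose (t.1.orderIsoOfFin t.2 j).1) := by
    refine LinearIndependent.of_comp
      (LinearMap.funLeft F F (fun i : Fin m => (s.1.orderIsoOfFin s.2 i).1)) ?_
    exact h1
  have h3 := h2.comp (t.1.orderIsoOfFin t.2).symm (t.1.orderIsoOfFin t.2).symm.injective
  have h4 : LinearIndependent F (fun r : {x // x ∈ t.1} => A.transpose r.1) := by
    convert h3 using 1
    funext r
    exact congrArg (fun x : {x // x ∈ t.1} => A.transpose x.1)
      ((t.1.orderIsoOfFin t.2).apply_symm_apply r).symm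
  exact h4

theorem compound_expand {I K R m : ℕ} (A : Matrix (Fin I) (Fin R) F) (C : Matrix (Fin K) (Fin R) F)
    (d : Fin R → F) (s : {s : Finset (Fin I) // s.card = m})
    (t : {t : Finset (Fin K) // t.card = m}) :
    (Matrix.of fun i j : Fin m => ∑ r, d r * A (s.1.orderIsoOfFin s.2 i).1 r *
      C (t.1.orderIsoOfFin t.2 j).1 r).det =
    ∑ u : {t : Finset (Fin R) // t.card = m}, hatVec m d u * (compound m A s u * compound m C t u) := by
  have := cauchyBinet_aux
    (Matrix.of fun (i : Fin m) (r : Fin R) => d r * A (s.1.orderIsoOfFin s.2 i).1 r)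
    (Matrix.of fun (r : Fin R) (j : Fin m) => C (t.1.orderIsoOfFin t.2 j).1 r)
  have h1 : (Matrix.of fun (i : Fin m) (r : Fin R) => d r * A (s.1.orderIsoOfFin s.2 i).1 r) *
    (Matrix.of fun (r : Fin R) (j : Fin m) => C (t.1.orderIsoOfFin t.2 j).1 r) =
    (Matrix.of fun i j : Fin m => ∑ r, d r * A (s.1.orderIsoOfFin s.2 i).1 r *
      C (t.1.orderIsoOfFin t.2 j).1 r) := by
    ext i j; simp [Matrix.mul_apply]
  rw [← h1, this]
  refine Finset.sum_congr rfl fun u _ => ?_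
  rw [← mul_assoc]
  congr 1
  · have h2 := Matrix.det_mul_row (fun j : Fin m => d (u.1.orderIsoOfFin u.2 j).1)
      (Matrix.of fun i j : Fin m => A (s.1.orderIsoOfFin s.2 i).1 (u.1.orderIsoOfFin u.2 j).1)
    have h3 : ∏ j : Fin m, d (u.1.orderIsoOfFin u.2 j).1 = hatVec m d u := by
      unfold hatVec
      rw [← Finset.prod_coe_sort u.1]
      exact (u.1.orderIsoOfFin u.2).toEquiv.prod_comp (fun x => d x.1)
    rw [h3] at h2
    exact h2
  · rw [← Matrix.det_transpose]; rfl

open scoped Classical in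
theorem weight_lt {I K R R' m : ℕ} (A : Matrix (Fin I) (Fin R) F) (C : Matrix (Fin K) (Fin R) F)
    (A' : Matrix (Fin I) (Fin R') F) (C' : Matrix (Fin K) (Fin R') F)
    (d : Fin R → F) (d' : Fin R' → F)
    (h : ∀ i k, ∑ r, d r * A i r * C k r = ∑ r, d' r * A' i r * C' k r)
    (h2 : FullColRank (khatriRao (compound m A) (compound m C)))
    (hd : (Finset.univ.filter fun r => d' r ≠ 0).card < m) :
    (Finset.univ.filter fun r => d r ≠ 0).card < m := by
  have hz : ∀ u, hatVec m d u = 0 := by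
    refine Fintype.linearIndependent_iff.1 h2 (hatVec m d) ?_
    funext p
    obtain ⟨s, t⟩ := p
    have e := compound_expand A C d s t
    have e' := compound_expand A' C' d' s t
    simp only [h] at e
    rw [e] at e'
    have : ∀ u, hatVec m d' u = 0 := by
      intro u
      unfold hatVec
      by_contra hne
      replace hne := Finset.prod_ne_zero_iff.1 hne
      have := Finset.card_le_card (s := u.1) (t := Finset.univ.filter fun r => d' r ≠ 0)
        (fun r hr => by simpa using hne r hr)
      rw [u.2] at this
      omega
    simp only [this, zero_mul, Finset.sum_const_zero] at e'
    rw [Finset.sum_apply]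
    exact e'
  by_contra hcon
  push Not at hcon
  obtain ⟨u, hu, hc⟩ := Finset.exists_subset_card_eq hcon
  have := hz ⟨u, hc⟩
  unfold hatVec at this
  rw [Finset.prod_eq_zero_iff] at this
  obtain ⟨r, hr, hr0⟩ := this
  have := hu hr
  simp at this
  exact this hr0

theorem sfs_compare {I K R R' : ℕ} (T : Fin I → Fin I → Fin K → F)
    (A : Matrix (Fin I) (Fin R) F) (C : Matrix (Fin K) (Fin R) F)
    (hPD : IsSFSPD T A C)
    (h1 : krank A + max (min (krank C - 1) (krank A)) (min (krank C) (krank A - 1)) ≥ R + 1)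
    (h2 : FullColRank (khatriRao (compound (R - A.rank + 2) A) (compound (R - A.rank + 2) C)))
    (A' : Matrix (Fin I) (Fin R') F) (C' : Matrix (Fin K) (Fin R') F)
    (hPD' : IsSFSPD T A' C') (hR : R' ≤ R) :
    R' = R ∧ ∃ σ : Fin R' → Fin R, Function.Injective σ ∧ ∃ la lc : Fin R' → F,
      (∀ r, la r * la r * lc r = 1) ∧
      (∀ i r, A' i r = A i (σ r) * la r) ∧
      (∀ k r, C' k r = C k (σ r) * lc r) := by
  classical
  obtain ⟨hA0, hC0, hT⟩ := hPD
  obtain ⟨hA0', hC0', hT'⟩ := hPD'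
  have hkA : krank A ≤ R := (krank_mem A).1
  have hkC : krank C ≤ R := (krank_mem C).1
  have hkA2 : 2 ≤ krank A := by omega
  have hkk : R + 1 ≤ krank A + krank A := by omega
  have hrk : A.rank = Module.finrank F (Submodule.span F (Set.range A.transpose)) := by
    rw [Matrix.rank_eq_finrank_span_cols]; rfl
  have hkr : krank A ≤ A.rank := by
    obtain ⟨s, -, hs⟩ := Finset.exists_subset_card_eq
      (s := (Finset.univ : Finset (Fin R))) (n := krank A) (by simpa using hkA)
    have h3 := krank_indep A s hs.le
    have h4 := finrank_span_eq_card (R := F) (b := fun r : (s : Set (Fin R)) => A.transpose r) h3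
    rw [hrk]
    have : krank A = Module.finrank F
        (Submodule.span F (Set.range fun r : (s : Set (Fin R)) => A.transpose r)) := by
      rw [h4]; simp [hs]
    rw [this]
    apply Submodule.finrank_mono
    apply Submodule.span_mono
    rintro _ ⟨r, rfl⟩
    exact ⟨r, rfl⟩
  have hrR : A.rank ≤ R := by simpa using A.rank_le_width
  generalize hm : R - A.rank + 2 = m at h2
  have hmR : m ≤ R := by omega
  have hAC : ∀ t : Finset (Fin R), t.card = m → LinearIndepOn F A.transpose (t : Set (Fin R)) ∧
      LinearIndepOn F C.transpose (t : Set (Fin R)) := by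
    intro t ht
    have hne := h2.ne_zero ⟨t, ht⟩
    obtain ⟨⟨s, s'⟩, hp⟩ := Function.ne_iff.1 hne
    have hp' : compound m A s ⟨t, ht⟩ * compound m C s' ⟨t, ht⟩ ≠ 0 := hp
    exact ⟨compound_indep A s ⟨t, ht⟩ (left_ne_zero_of_mul hp'),
      compound_indep C s' ⟨t, ht⟩ (right_ne_zero_of_mul hp')⟩
  have hAm := indep_extend A.transpose hmR (fun s hs => (hAC s hs).1)
  have hCm := indep_extend C.transpose hmR (fun s hs => (hAC s hs).2)
  have hTT : ∀ i j k, ∑ r, A i r * A j r * C k r = ∑ r, A' i r * A' j r * C' k r := by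
    intro i j k
    exact congrFun (congrFun (congrFun (hT.symm.trans hT') i) j) k
  have hcon : ∀ (f : Module.Dual F (Fin I → F)) (j : Fin I) (k : Fin K),
      ∑ r, f (A.transpose r) * A j r * C k r = ∑ r, f (A'.transpose r) * A' j r * C' k r := by
    intro f j k
    have : ∑ r, (A j r * C k r) • A.transpose r = ∑ r, (A' j r * C' k r) • A'.transpose r := by
      funext i
      simp only [Finset.sum_apply, Pi.smul_apply, Matrix.transpose_apply, smul_eq_mul]
      have := hTT i j k
      calc _ = ∑ r, A i r * A j r * C k r := Finset.sum_congr rfl fun r _ => by ring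
        _ = _ := this
        _ = _ := Finset.sum_congr rfl fun r _ => by ring
    have := congrArg f this
    simp only [map_sum, map_smul, smul_eq_mul] at this
    calc _ = ∑ r, A j r * C k r * f (A.transpose r) := Finset.sum_congr rfl fun r _ => by ring
      _ = _ := this
      _ = _ := Finset.sum_congr rfl fun r _ => by ring
  have hcon2 : ∀ (f : Module.Dual F (Fin I → F)) (g : Module.Dual F (Fin K → F)),
      ∑ r, (f (A.transpose r) * g (C.transpose r)) • A.transpose r =
        ∑ r, (f (A'.transpose r) * g (C'.transpose r)) • A'.transpose r := by
    intro f g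
    funext j
    have : ∑ r, (f (A.transpose r) * A j r) • C.transpose r =
        ∑ r, (f (A'.transpose r) * A' j r) • C'.transpose r := by
      funext k
      simp only [Finset.sum_apply, Pi.smul_apply, Matrix.transpose_apply, smul_eq_mul]
      exact hcon f j k
    have := congrArg g this
    simp only [map_sum, map_smul, smul_eq_mul] at this
    simp only [Finset.sum_apply, Pi.smul_apply, smul_eq_mul]
    calc _ = ∑ r, f (A.transpose r) * A j r * g (C.transpose r) :=
          Finset.sum_congr rfl fun r _ => by rw [Matrix.transpose_apply A]; ring
      _ = _ := this
      _ = _ := Finset.sum_congr rfl fun r _ => by rw [Matrix.transpose_apply A']; ring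
  obtain ⟨hRR, σ, hσ, l, hl⟩ := perm_lemma (F := F) (m := m) A.transpose A'.transpose hR
    (by rw [← hrk]; omega) (by omega) (by
      intro f hf
      have hw := weight_lt A C A' C' (fun r => f (A.transpose r)) (fun r => f (A'.transpose r))
        (hcon f) h2 (by omega)
      refine rank_weight (F := F) A.transpose C.transpose A'.transpose C'.transpose
        (fun r => f (A.transpose r)) (fun r => f (A'.transpose r)) _ _ ?_ ?_ ?_
        (hAm _ hw.le) (hCm _ hw.le) (hcon2 f)
      · intro r hr; simpa using hr
      · intro r hr; simpa using hr
      · intro r hr; simpa using hr) hA0 (by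
      intro r s c hrs
      by_contra hne
      have hi := krank_indep A {r, s} (by rw [Finset.card_pair hne]; exact hkA2)
      obtain ⟨f, hf1, hf0⟩ := exists_dual_of_indep hi (j := r) (by simp)
      have := hf0 s (by simp) (Ne.symm hne)
      rw [hrs, map_smul, this] at hf1
      simp at hf1)
  refine ⟨hRR, σ, hσ, l, fun r => (l r * l r)⁻¹, ?_, ?_, ?_⟩
  · intro r
    have hl0 : l r ≠ 0 := by
      intro h0
      apply hA0' r
      rw [hl r, h0, zero_smul]
    field_simp
  · intro i r
    have := congrFun (hl r) i
    simp only [Matrix.transpose_apply, Pi.smul_apply, smul_eq_mul] at this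
    rw [this, mul_comm]
  · subst hRR
    have hbij : Function.Bijective σ := Finite.injective_iff_bijective.1 hσ
    let τ : Fin R' ≃ Fin R' := Equiv.ofBijective σ hbij
    have hA' : ∀ i r, A' i r = A i (σ r) * l r := by
      intro i r
      have := congrFun (hl r) i
      simp only [Matrix.transpose_apply, Pi.smul_apply, smul_eq_mul] at this
      rw [this, mul_comm]
    intro k r
    have hl0 : l r ≠ 0 := by
      intro h0
      apply hA0' r
      rw [hl r, h0, zero_smul]
    have := kr_inj (F := F) A.transpose hkA hkk (krank_indep A)
      (fun s => C k s - C' k (τ.symm s) * (l (τ.symm s) * l (τ.symm s))) (by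
        intro f
        have hB : ∑ r, (C k r * f (A.transpose r)) • A.transpose r =
            ∑ r, (C' k r * f (A'.transpose r)) • A'.transpose r := by
          funext j
          simp only [Finset.sum_apply, Pi.smul_apply, smul_eq_mul]
          calc _ = ∑ r, f (A.transpose r) * A j r * C k r :=
                Finset.sum_congr rfl fun r _ => by rw [Matrix.transpose_apply A]; ring
            _ = _ := hcon f j k
            _ = _ := Finset.sum_congr rfl fun r _ => by rw [Matrix.transpose_apply A']; ring
        have hB2 : ∑ r, (C' k r * f (A'.transpose r)) • A'.transpose r =
            ∑ s, (C' k (τ.symm s) * (l (τ.symm s) * l (τ.symm s)) * f (A.transpose s)) •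
              A.transpose s := by
          rw [← τ.sum_comp (fun s => (C' k (τ.symm s) * (l (τ.symm s) * l (τ.symm s)) *
            f (A.transpose s)) • A.transpose s)]
          refine Finset.sum_congr rfl fun r _ => ?_
          rw [hl r]
          simp only [Equiv.symm_apply_apply, map_smul, smul_eq_mul, smul_smul]
          change _ = _ • A.transpose (σ r)
          congr 1
          change _ = C' k r * (l r * l r) * f (A.transpose (σ r))
          ring
        simp only [sub_mul, sub_smul, Finset.sum_sub_distrib]
        rw [hB, hB2, sub_self]) (τ r)
    simp only [Equiv.symm_apply_apply] at this
    have h5 : C k (σ r) = C' k r * (l r * l r) := sub_eq_zero.1 this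
    rw [h5]
    field_simp

/-- Proposition 4.11: uniqueness of the SFS-CPD. -/
theorem stmt_16 {I K R : ℕ} (T : Fin I → Fin I → Fin K → F)
    (A : Matrix (Fin I) (Fin R) F) (C : Matrix (Fin K) (Fin R) F)
    (hPD : IsSFSPD T A C)
    (h1 : krank A + max (min (krank C - 1) (krank A)) (min (krank C) (krank A - 1)) ≥ R + 1)
    (h2 : FullColRank (khatriRao (compound (R - A.rank + 2) A) (compound (R - A.rank + 2) C))) :
    sfsRank T = R ∧ SFSCPDUnique T R := by
  have hmem : R ∈ {R | ∃ A : Matrix (Fin I) (Fin R) F, ∃ C : Matrix (Fin K) (Fin R) F,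
      IsSFSPD T A C} := ⟨A, C, hPD⟩
  constructor
  · refine le_antisymm (Nat.sInf_le hmem) ?_
    obtain ⟨A', C', h'⟩ := Nat.sInf_mem ⟨R, hmem⟩
    rcases le_total (sfsRank T) R with hle | hle
    · exact (sfs_compare T A C hPD h1 h2 A' C' h' hle).1.ge
    · exact hle
  · intro A1 A2 C1 C2 hP1 hP2
    obtain ⟨-, σ1, hσ1, la1, lc1, hl1, hA1, hC1⟩ := sfs_compare T A C hPD h1 h2 A1 C1 hP1 le_rfl
    obtain ⟨-, σ2, hσ2, la2, lc2, hl2, hA2, hC2⟩ := sfs_compare T A C hPD h1 h2 A2 C2 hP2 le_rfl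
    let τ1 : Fin R ≃ Fin R := Equiv.ofBijective σ1 (Finite.injective_iff_bijective.1 hσ1)
    let τ2 : Fin R ≃ Fin R := Equiv.ofBijective σ2 (Finite.injective_iff_bijective.1 hσ2)
    have hs : ∀ r, σ1 (τ1.symm (τ2 r)) = σ2 r := fun r => τ1.apply_symm_apply (τ2 r)
    have hla : ∀ r, la1 r ≠ 0 := fun r h0 => by have := hl1 r; simp [h0] at this
    have hlc : ∀ r, lc1 r ≠ 0 := fun r h0 => by have := hl1 r; simp [h0] at this
    refine ⟨τ2.trans τ1.symm, fun r => la2 r / la1 (τ1.symm (τ2 r)),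
      fun r => lc2 r / lc1 (τ1.symm (τ2 r)), ?_, ?_, ?_⟩
    · intro r
      have e1 := hl1 (τ1.symm (τ2 r))
      have e2 := hl2 r
      have n1 := hla (τ1.symm (τ2 r))
      have n2 := hlc (τ1.symm (τ2 r))
      rw [div_mul_div_comm, div_mul_div_comm, e1, e2, div_one]
    · intro i r
      have n1 := hla (τ1.symm (τ2 r))
      rw [Equiv.trans_apply, hA1, hs, hA2]
      field_simp
    · intro i r
      have n1 := hlc (τ1.symm (τ2 r))
      rw [Equiv.trans_apply, hC1, hs, hC2]
      field_simp
end
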